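/- arXiv:1712.01079 — 2 statements merged into one kernel-verified Lean document; each statement's English description precedes it below -/
import Mathlib

section
/- Let Γ satisfy the Standing Assumptions with embedding f, and let (Γ_1, Γ_2) be a strong visual decomposition of Γ along a 4-cycle σ with respect to f. Then σ does not strongly separate any subgraph K of Γ_i containing σ (with respect to the restricted embedding), and any 4-cycle α in some Γ_i that strongly separates Γ_i also strongly separates Γ. -/
open Set

namespace Paper

/-- Word metric distance with respect to a (symmetrized) generating set `S`. -/
noncomputable def wordDist {G : Type*} [Group G] (S : Set G) (g h : G) : ℕ :=
  sInf {n | ∃ w : List G, w.length = n ∧ (∀ x ∈ w, x ∈ S ∨ x⁻¹ ∈ S) ∧ g⁻¹ * h = w.prod}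

/-- A discrete `(K, C)`-quasi-geodesic in the word metric. -/
def IsQuasiGeodesic {G : Type*} [Group G] (S : Set G) (K C : ℝ) {n : ℕ}
    (q : Fin (n + 1) → G) : Prop :=
  ∀ i j : Fin (n + 1),
    (wordDist S (q i) (q j) : ℝ) ≤ K * |((i : ℕ) : ℝ) - ((j : ℕ) : ℝ)| + C ∧
      |((i : ℕ) : ℝ) - ((j : ℕ) : ℝ)| / K - C ≤ (wordDist S (q i) (q j) : ℝ)

/-- A subset `H` is strongly quasiconvex (Morse) with respect to the word metric of `S`:
every quasi-geodesic with endpoints in `H` stays uniformly close to `H`. -/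
def StronglyQuasiconvex {G : Type*} [Group G] (S : Set G) (H : Set G) : Prop :=
  ∀ K C : ℝ, 1 ≤ K → 0 ≤ C → ∃ M : ℝ, ∀ (n : ℕ) (q : Fin (n + 1) → G),
    q 0 ∈ H → q (Fin.last n) ∈ H → IsQuasiGeodesic S K C q →
      ∀ i, ∃ h ∈ H, (wordDist S (q i) h : ℝ) ≤ M

/-- The subgroup `H` (with generating data `T`) is undistorted in `G` (with generating data `S`):
the inclusion is a quasi-isometric embedding for the word metrics. -/
def Undistorted {G : Type*} [Group G] (S : Set G) (H : Subgroup G) (T : Set H) : Prop :=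
  ∃ K C : ℝ, 1 ≤ K ∧ 0 ≤ C ∧ ∀ a b : H,
    (wordDist T a b : ℝ) ≤ K * (wordDist S (a : G) (b : G)) + C ∧
      (wordDist S (a : G) (b : G) : ℝ) ≤ K * (wordDist T a b) + C

/-- Quasi-isometry between two groups with chosen generating sets. -/
def QuasiIsometric (G : Type*) [Group G] (S : Set G) (H : Type*) [Group H] (T : Set H) :
    Prop :=
  ∃ (φ : G → H) (K C : ℝ), 1 ≤ K ∧ 0 ≤ C ∧
    (∀ a b : G,
      (wordDist T (φ a) (φ b) : ℝ) ≤ K * (wordDist S a b) + C ∧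
        (wordDist S a b : ℝ) ≤ K * (wordDist T (φ a) (φ b)) + C) ∧
    ∀ h : H, ∃ g : G, (wordDist T (φ g) h : ℝ) ≤ C

/-- A group action on a graph by graph automorphisms. -/
def ActsOnGraph (G : Type*) [Group G] {V : Type*} [MulAction G V] (Γ : SimpleGraph V) :
    Prop :=
  ∀ (g : G) (v w : V), Γ.Adj v w → Γ.Adj (g • v) (g • w)

/-- Relators of the right-angled Coxeter group of a graph. -/
def racgRels {V : Type*} (Γ : SimpleGraph V) : Set (FreeGroup V) :=
  {r | ∃ v : V, r = FreeGroup.of v * FreeGroup.of v} ∪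
    {r | ∃ v w : V, Γ.Adj v w ∧ r = (FreeGroup.of v * FreeGroup.of w) ^ 2}

/-- The right-angled Coxeter group of a simplicial graph. -/
abbrev RACG {V : Type*} (Γ : SimpleGraph V) : Type _ := PresentedGroup (racgRels Γ)

/-- The standard (vertex) generating set of a RACG. -/
def racgGen {V : Type*} (Γ : SimpleGraph V) : Set (RACG Γ) :=
  Set.range fun v : V => (PresentedGroup.of v : RACG Γ)

/-- The special subgroup of a RACG generated by a set of vertices. -/
def specialSubgroup {V : Type*} (Γ : SimpleGraph V) (J : Set V) : Subgroup (RACG Γ) :=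
  Subgroup.closure ((fun v : V => (PresentedGroup.of v : RACG Γ)) '' J)

/-- Relators of the right-angled Artin group of a graph. -/
def raagRels {V : Type*} (Γ : SimpleGraph V) : Set (FreeGroup V) :=
  {r | ∃ v w : V, Γ.Adj v w ∧
    r = FreeGroup.of v * FreeGroup.of w * (FreeGroup.of v)⁻¹ * (FreeGroup.of w)⁻¹}

/-- The right-angled Artin group of a simplicial graph. -/
abbrev RAAG {V : Type*} (Γ : SimpleGraph V) : Type _ := PresentedGroup (raagRels Γ)

/-- The standard (vertex) generating set of a RAAG. -/
def raagGen {V : Type*} (Γ : SimpleGraph V) : Set (RAAG Γ) :=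
  Set.range fun v : V => (PresentedGroup.of v : RAAG Γ)

/-- The coned-off Cayley graph of `G` with respect to the generating set `S` and the
peripheral collection `P`. -/
def conedOffCayley (G : Type*) [Group G] (S : Set G) {ι : Type*} (P : ι → Subgroup G) :
    SimpleGraph (G ⊕ Σ i : ι, G ⧸ P i) :=
  SimpleGraph.fromRel fun x y =>
    match x, y with
    | Sum.inl g, Sum.inl h => g⁻¹ * h ∈ S
    | Sum.inl g, Sum.inr ⟨i, c⟩ => (QuotientGroup.mk g : G ⧸ P i) = c
    | _, _ => False

/-- A connected graph is hyperbolic if its path metric satisfies the four-point condition. -/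
def IsHyperbolicGraph {α : Type*} (Γ : SimpleGraph α) : Prop :=
  Γ.Connected ∧ ∃ δ : ℝ, 0 ≤ δ ∧ ∀ x y z w : α,
    (Γ.dist x y : ℝ) + (Γ.dist z w : ℝ) ≤
      max ((Γ.dist x z : ℝ) + (Γ.dist y w : ℝ)) ((Γ.dist x w : ℝ) + (Γ.dist y z : ℝ)) + δ

/-- A graph is fine if each edge lies in only finitely many circuits of each bounded length. -/
def IsFineGraph {α : Type*} (Γ : SimpleGraph α) : Prop :=
  ∀ (n : ℕ) (v w : α), Γ.Adj v w →
    {p : Γ.Walk v v | p.IsCircuit ∧ p.length ≤ n ∧ s(v, w) ∈ p.edges}.Finite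

/-- `G` is hyperbolic relative to the finite collection of subgroups `P`. -/
def RelativelyHyperbolic (G : Type*) [Group G] {ι : Type*} (P : ι → Subgroup G) : Prop :=
  Finite ι ∧ ∃ S : Finset G, Subgroup.closure (S : Set G) = ⊤ ∧
    IsHyperbolicGraph (conedOffCayley G (S : Set G) P) ∧
    IsFineGraph (conedOffCayley G (S : Set G) P)

/-- There is a path from `x` to `y` of length at most `L` in the Cayley graph of `(G,S)`
avoiding the ball of radius `r` about the identity. -/
def PathAvoiding {G : Type*} [Group G] (S : Set G) (r : ℕ) (x y : G) (L : ℕ) : Prop :=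
  ∃ (m : ℕ) (p : Fin (m + 1) → G), p 0 = x ∧ p (Fin.last m) = y ∧ m ≤ L ∧
    (∀ i : Fin m, wordDist S (p i.castSucc) (p i.succ) ≤ 1) ∧
    ∀ i, r ≤ wordDist S 1 (p i)

/-- The divergence of `(G,S)` is bounded above by (a linear function of) `f`. -/
def DivergenceUpperBound (G : Type*) [Group G] (S : Set G) (f : ℕ → ℕ) : Prop :=
  ∃ A B : ℕ, 0 < A ∧ ∀ (n : ℕ) (x y : G), wordDist S 1 x = n → wordDist S 1 y = n →
    PathAvoiding S (n / 2) x y (A * f n + B)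

/-- The divergence of `(G,S)` is bounded below by (a linear function of) `f`. -/
def DivergenceLowerBound (G : Type*) [Group G] (S : Set G) (f : ℕ → ℕ) : Prop :=
  ∃ A B : ℕ, 0 < A ∧ ∀ N : ℕ, ∃ n, N ≤ n ∧ ∃ x y : G,
    wordDist S 1 x = n ∧ wordDist S 1 y = n ∧
    ∀ L : ℕ, PathAvoiding S (n / 2) x y L → f n ≤ A * L + B

def HasLinearDivergence (G : Type*) [Group G] (S : Set G) : Prop :=
  DivergenceUpperBound G S (fun n => n) ∧ DivergenceLowerBound G S (fun n => n)

def HasQuadraticDivergence (G : Type*) [Group G] (S : Set G) : Prop :=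
  DivergenceUpperBound G S (fun n => n ^ 2) ∧ DivergenceLowerBound G S (fun n => n ^ 2)

def HasExponentialDivergence (G : Type*) [Group G] (S : Set G) : Prop :=
  (∃ b : ℕ, 2 ≤ b ∧ DivergenceUpperBound G S (fun n => b ^ n)) ∧
    DivergenceLowerBound G S (fun n => 2 ^ n)

/-- `c` parametrizes an induced 4-cycle of `Γ`. -/
def IsInducedFourCycle {V : Type*} (Γ : SimpleGraph V) (c : Fin 4 → V) : Prop :=
  Function.Injective c ∧ ∀ i j : Fin 4, Γ.Adj (c i) (c j) ↔ (j = i + 1 ∨ i = j + 1)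

/-- `s` is the vertex set of an induced 4-cycle of `Γ`. -/
def IsFourCycleSet {V : Type*} (Γ : SimpleGraph V) (s : Set V) : Prop :=
  ∃ c : Fin 4 → V, IsInducedFourCycle Γ c ∧ Set.range c = s

/-- The four-cycle graph `Γ⁴`: vertices are the induced 4-cycles of `Γ`, adjacent when the
corresponding 4-cycles share a pair of non-adjacent vertices. -/
def fourCycleGraph {V : Type*} (Γ : SimpleGraph V) :
    SimpleGraph {s : Set V // IsFourCycleSet Γ s} :=
  SimpleGraph.fromRel fun s t =>
    ∃ a b : V, a ≠ b ∧ ¬ Γ.Adj a b ∧ a ∈ s.1 ∩ t.1 ∧ b ∈ s.1 ∩ t.1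

/-- `Γ` is CFS: `Γ = Ω * K` with `K` a (possibly empty) clique and `Ω` nonempty such that
`Ω⁴` has a connected component whose support is all of `V(Ω)`. -/
def CFS {V : Type*} (Γ : SimpleGraph V) : Prop :=
  ∃ Ω K : Set V, Ω ∪ K = Set.univ ∧ Disjoint Ω K ∧ Ω.Nonempty ∧
    (∀ a ∈ K, ∀ b ∈ K, a ≠ b → Γ.Adj a b) ∧
    (∀ a ∈ Ω, ∀ b ∈ K, Γ.Adj a b) ∧
    ∃ s₀ : {s : Set ↥Ω // IsFourCycleSet (Γ.induce Ω) s},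
      ∀ v : ↥Ω, ∃ t : {s : Set ↥Ω // IsFourCycleSet (Γ.induce Ω) s},
        (fourCycleGraph (Γ.induce Ω)).Reachable s₀ t ∧ v ∈ t.1

/-- A (topological) planar embedding of the graph `Γ`: vertices go to distinct points of the
plane, each edge to an arc between the images of its endpoints, arcs meeting only at common
endpoint vertices. -/
structure PlanarEmbedding {V : Type*} (Γ : SimpleGraph V) where
  vmap : V → ℝ × ℝ
  inj : Function.Injective vmap
  emap : Sym2 V → Set (ℝ × ℝ)
  arc : ∀ ⦃u v : V⦄, Γ.Adj u v → ∃ γ : Path (vmap u) (vmap v),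
    Function.Injective (⇑γ) ∧ Set.range (⇑γ) = emap s(u, v)
  disjointEdges : ∀ e ∈ Γ.edgeSet, ∀ e' ∈ Γ.edgeSet, e ≠ e' →
    emap e ∩ emap e' ⊆ Set.range vmap
  vertexOnEdge : ∀ e ∈ Γ.edgeSet, ∀ v : V, vmap v ∈ emap e → v ∈ e

/-- The image in the plane of the full subgraph of `Γ` spanned by the vertex set `W`. -/
def PlanarEmbedding.imageOf {V : Type*} {Γ : SimpleGraph V} (f : PlanarEmbedding Γ)
    (W : Set V) : Set (ℝ × ℝ) :=
  (f.vmap '' W) ∪ ⋃ (e : Sym2 V) (_ : e ∈ Γ.edgeSet) (_ : ∀ x ∈ e, x ∈ W), f.emap e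

/-- The 4-cycle `c` strongly separates the subgraph of `Γ` spanned by `W` with respect to the
embedding `f`: the image of the subgraph meets (at least) two distinct connected components of
the complement of the image of `c`. -/
def StronglySeparatesIn {V : Type*} {Γ : SimpleGraph V} (f : PlanarEmbedding Γ)
    (c : Fin 4 → V) (W : Set V) : Prop :=
  ∃ x y : ℝ × ℝ, x ∈ f.imageOf W ∧ y ∈ f.imageOf W ∧
    x ∉ f.imageOf (Set.range c) ∧ y ∉ f.imageOf (Set.range c) ∧
    y ∉ connectedComponentIn (f.imageOf (Set.range c))ᶜ x

/-- `(W₁, W₂)` is a strong visual decomposition of `Γ` along the induced 4-cycle `c`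
with respect to the embedding `f`. -/
def StrongVisualDecomposition {V : Type*} {Γ : SimpleGraph V} (f : PlanarEmbedding Γ)
    (c : Fin 4 → V) (W₁ W₂ : Set V) : Prop :=
  IsInducedFourCycle Γ c ∧
  W₁ ∪ W₂ = Set.univ ∧ W₁ ∩ W₂ = Set.range c ∧
  (W₁ \ Set.range c).Nonempty ∧ (W₂ \ Set.range c).Nonempty ∧
  (∀ v ∈ W₁ \ Set.range c, ∀ w ∈ W₂ \ Set.range c,
    f.vmap w ∉ connectedComponentIn (f.imageOf (Set.range c))ᶜ (f.vmap v)) ∧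
  (∀ u v : V, Γ.Adj u v → (u ∈ W₁ ∧ v ∈ W₁) ∨ (u ∈ W₂ ∧ v ∈ W₂))

/-- Standing Assumptions: connected, triangle-free, planar, at least five vertices,
no separating vertices or edges. -/
def StandingAssumptions {V : Type*} (Γ : SimpleGraph V) : Prop :=
  Γ.Connected ∧ Γ.CliqueFree 3 ∧ Nonempty (PlanarEmbedding Γ) ∧ 5 ≤ Nat.card V ∧
  (∀ v : V, (Γ.induce ({v}ᶜ : Set V)).Connected) ∧
  (∀ u v : V, Γ.Adj u v → (Γ.induce ({u, v}ᶜ : Set V)).Connected)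

/-- `Γ` contains (as a subgraph) a suspension of three distinct points. -/
def ContainsSuspThree {V : Type*} (Γ : SimpleGraph V) : Prop :=
  ∃ (a : Fin 3 → V) (b : Fin 2 → V), Function.Injective a ∧ Function.Injective b ∧
    (∀ i j, a i ≠ b j) ∧ ∀ i j, Γ.Adj (a i) (b j)

/-- `Γ` is (exactly) the suspension of three distinct points. -/
def IsSuspensionOfThreePoints {V : Type*} (Γ : SimpleGraph V) : Prop :=
  ∃ (a : Fin 3 → V) (b : Fin 2 → V), Function.Injective a ∧ Function.Injective b ∧
    (∀ i j, a i ≠ b j) ∧ Set.range a ∪ Set.range b = Set.univ ∧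
    ∀ x y : V, Γ.Adj x y ↔ ((∃ i j, x = a i ∧ y = b j) ∨ (∃ i j, x = b j ∧ y = a i))

/-- `Γ` is a suspension of a set of distinct (pairwise non-adjacent) vertices. -/
def IsSuspension {V : Type*} (Γ : SimpleGraph V) : Prop :=
  ∃ b₁ b₂ : V, b₁ ≠ b₂ ∧ ¬ Γ.Adj b₁ b₂ ∧
    (∀ v, v ≠ b₁ → v ≠ b₂ → Γ.Adj v b₁ ∧ Γ.Adj v b₂) ∧
    (∀ u v, u ≠ b₁ → u ≠ b₂ → v ≠ b₁ → v ≠ b₂ → ¬ Γ.Adj u v)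

/-- `Γ` is a join of two nonempty subgraphs. -/
def IsJoin {V : Type*} (Γ : SimpleGraph V) : Prop :=
  ∃ A B : Set V, A.Nonempty ∧ B.Nonempty ∧ Disjoint A B ∧ A ∪ B = Set.univ ∧
    ∀ a ∈ A, ∀ b ∈ B, Γ.Adj a b

/-- `Γ` is prime: not a 4-cycle, and some planar embedding has no strongly separating
4-cycle. -/
def IsPrime {V : Type*} (Γ : SimpleGraph V) : Prop :=
  (¬ ∃ c : Fin 4 → V, IsInducedFourCycle Γ c ∧ Set.range c = Set.univ) ∧
  ∃ f : PlanarEmbedding Γ, ∀ c : Fin 4 → V, IsInducedFourCycle Γ c →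
    ¬ StronglySeparatesIn f c Set.univ

/-- The closed half-space model for 3-manifolds with boundary. -/
def HalfSpace3 : Set (Fin 3 → ℝ) := {y | 0 ≤ y 0}

/-- A topological 3-manifold, possibly with boundary. -/
def IsManifold3WithBoundary (M : Type*) [TopologicalSpace M] : Prop :=
  T2Space M ∧ SecondCountableTopology M ∧ ∀ x : M, ∃ U : Set M, IsOpen U ∧ x ∈ U ∧
    ∃ W : Set ↥HalfSpace3, IsOpen W ∧ Nonempty (↥U ≃ₜ ↥W)

/-- A compact 3-manifold foliated by circles (Seifert fibered, by Epstein's theorem). -/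
def SeifertLike (M : Type*) [TopologicalSpace M] : Prop :=
  IsManifold3WithBoundary M ∧ CompactSpace M ∧ Nonempty M ∧
  ∃ (B : Type) (_ : TopologicalSpace B) (p : M → B),
    Continuous p ∧ Function.Surjective p ∧ ∀ b : B, Nonempty (↥(p ⁻¹' {b}) ≃ₜ Circle)

abbrev Torus : Type := Circle × Circle

/-- A (non-geometric) graph manifold: a compact 3-manifold, not itself Seifert fibered,
which is a union of finitely many closed Seifert pieces meeting along disjoint unions of
tori. -/
def IsGraphManifold (M : Type*) [TopologicalSpace M] : Prop :=
  IsManifold3WithBoundary M ∧ CompactSpace M ∧ ¬ SeifertLike M ∧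
  ∃ (n : ℕ) (P : Fin n → Set M),
    (⋃ i, P i) = Set.univ ∧
    (∀ i, IsClosed (P i) ∧ SeifertLike ↥(P i)) ∧
    ∀ i j, i ≠ j → ∃ k : ℕ, Nonempty (↥(P i ∩ P j) ≃ₜ (Fin k × Torus))

/-- A pointed topological space. -/
structure PointedSpace where
  carrier : Type
  top : TopologicalSpace carrier
  pt : carrier

attribute [instance] PointedSpace.top

/-- `G` is virtually the fundamental group of a Seifert fibered 3-manifold. -/
def VirtuallySeifert (G : Type*) [Group G] : Prop :=
  ∃ H : Subgroup G, H.FiniteIndex ∧ ∃ X : PointedSpace,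
    SeifertLike X.carrier ∧ Nonempty (H ≃* FundamentalGroup X.carrier X.pt)

/-- `G` is virtually the fundamental group of a graph manifold. -/
def VirtuallyGraphManifold (G : Type*) [Group G] : Prop :=
  ∃ H : Subgroup G, H.FiniteIndex ∧ ∃ X : PointedSpace,
    IsGraphManifold X.carrier ∧ Nonempty (H ≃* FundamentalGroup X.carrier X.pt)

/-- A vertex-colored graph. -/
structure ColoredGraph (C : Type*) where
  V : Type
  graph : SimpleGraph V
  color : V → C

/-- A weak covering of colored graphs: a color-preserving graph homomorphism with the
edge-lifting property. -/
def WeakCovering {C : Type*} (Λ Λ' : ColoredGraph C) (f : Λ.V → Λ'.V) : Prop :=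
  (∀ v, Λ'.color (f v) = Λ.color v) ∧
  (∀ v w, Λ.graph.Adj v w → Λ'.graph.Adj (f v) (f w)) ∧
  (∀ v w', Λ'.graph.Adj (f v) w' → ∃ w, Λ.graph.Adj v w ∧ f w = w')

/-- Two colored graphs are bisimilar if they weakly cover a common colored graph. -/
def Bisimilar {C : Type*} (Λ₁ Λ₂ : ColoredGraph C) : Prop :=
  ∃ (Λ : ColoredGraph C) (f₁ : Λ₁.V → Λ.V) (f₂ : Λ₂.V → Λ.V),
    WeakCovering Λ₁ Λ f₁ ∧ WeakCovering Λ₂ Λ f₂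

/-- Isomorphism of colored graphs. -/
def ColoredIso {C : Type*} (Λ₁ Λ₂ : ColoredGraph C) : Prop :=
  ∃ e : Λ₁.V ≃ Λ₂.V, (∀ v, Λ₂.color (e v) = Λ₁.color v) ∧
    ∀ v w, Λ₁.graph.Adj v w ↔ Λ₂.graph.Adj (e v) (e w)
/-- A visual decomposition tree of a CFS graph `Γ` satisfying the Standing Assumptions:
a finite tree whose vertices carry suspension subgraphs `Γv t = susp(Av t)` (with the two
suspension points `pole1 t`, `pole2 t`), glued along induced 4-cycles. -/
structure VisualDecompTree (V : Type*) (Γ : SimpleGraph V) where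
  T : Type
  finite : Finite T
  tree : SimpleGraph T
  isTree : tree.IsTree
  Γv : T → Set V
  Av : T → Set V
  pole1 : T → V
  pole2 : T → V
  susp : ∀ t : T,
    pole1 t ≠ pole2 t ∧ ¬ Γ.Adj (pole1 t) (pole2 t) ∧
    Γv t = Av t ∪ {pole1 t, pole2 t} ∧ pole1 t ∉ Av t ∧ pole2 t ∉ Av t ∧
    (∀ a ∈ Av t, Γ.Adj a (pole1 t) ∧ Γ.Adj a (pole2 t)) ∧
    (∀ a ∈ Av t, ∀ b ∈ Av t, ¬ Γ.Adj a b)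
  three : ∀ t : T, 3 ≤ Nat.card (Av t)
  distinct : Function.Injective Γv
  covers : (⋃ t : T, Γv t) = Set.univ
  edges4 : ∀ t₁ t₂ : T, tree.Adj t₁ t₂ →
    Γv t₁ ∩ Γv t₂ = {pole1 t₁, pole2 t₁, pole1 t₂, pole2 t₂} ∧
    IsFourCycleSet Γ (Γv t₁ ∩ Γv t₂)
  nonedges : ∀ t₁ t₂ : T, t₁ ≠ t₂ → ¬ tree.Adj t₁ t₂ →
    ¬ IsFourCycleSet Γ (Γv t₁ ∩ Γv t₂)
  polesIn : ∀ t₁ t₂ : T, tree.Adj t₁ t₂ → pole1 t₁ ∈ Av t₂ ∧ pole2 t₁ ∈ Av t₂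

/-- The weight of a vertex of a visual decomposition tree. -/
noncomputable def VisualDecompTree.weight {V : Type*} {Γ : SimpleGraph V} (D : VisualDecompTree V Γ)
    (t : D.T) : ℕ := Nat.card (D.Av t)

/-- The degree of a vertex of a visual decomposition tree. -/
noncomputable def VisualDecompTree.degree {V : Type*} {Γ : SimpleGraph V} (D : VisualDecompTree V Γ)
    (t : D.T) : ℕ := Nat.card (D.tree.neighborSet t)

/-- A vertex is black if its weight strictly exceeds its degree (white otherwise). -/
def VisualDecompTree.Black {V : Type*} {Γ : SimpleGraph V} (D : VisualDecompTree V Γ)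
    (t : D.T) : Prop := D.degree t < D.weight t

/-- The visual decomposition tree as a colored graph (colored by the black/white property). -/
def VisualDecompTree.colored {V : Type*} {Γ : SimpleGraph V} (D : VisualDecompTree V Γ) :
    ColoredGraph Prop :=
  ⟨D.T, D.tree, fun t => D.Black t⟩


lemma isSimplyConnected_univ {X : Type*} [TopologicalSpace X] [SimplyConnectedSpace X] :
    IsSimplyConnected (univ : Set X) :=
  (Homeomorph.Set.univ X).toHomotopyEquiv.simplyConnectedSpace

/-- Every nonvanishing continuous complex function on `K` has a continuous logarithm on `K`. -/
def HasContinuousLogs {X : Type*} [TopologicalSpace X] (K : Set X) : Prop :=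
  ∀ f : X → ℂ, ContinuousOn f K → (∀ z ∈ K, f z ≠ 0) →
    ∃ g : X → ℂ, ContinuousOn g K ∧ ∀ z ∈ K, Complex.exp (g z) = f z

lemma hasContinuousLogs_range_of_injective {X : Type*} [TopologicalSpace X] [T2Space X]
    (γ : C(unitInterval, X)) (hγ : Function.Injective γ) : HasContinuousLogs (range γ) := by
  intro f hf h_ne
  have hfγ : Continuous (f ∘ γ) :=
    hf.comp_continuous γ.continuous fun t => mem_range_self t
  obtain ⟨h, hh, h_exp⟩ := Complex.exists_continuousOn_eqOn_exp_comp (U := (univ : Set ℝ))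
    (g := IccExtend zero_le_one (f ∘ γ)) (isSimplyConnected_univ)
    isOpen_univ (continuous_IccExtend_iff.2 hfγ).continuousOn
    (by
      rintro ⟨t, -, ht⟩
      exact h_ne _ (mem_range_self _) ht)
  have hemb : Topology.IsEmbedding γ :=
    (γ.continuous.isClosedEmbedding hγ).isEmbedding
  refine ⟨Function.extend γ (fun t => h t) 0, ?_, ?_⟩
  · rw [continuousOn_iff_continuous_domRestrict]
    have hc : Continuous fun t : unitInterval => h t :=
      (continuousOn_univ.1 hh).comp continuous_subtype_val
    convert! hc.comp hemb.toHomeomorph.symm.continuous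
    ext ⟨z, t, rfl⟩
    have : hemb.toHomeomorph.symm ⟨γ t, t, rfl⟩ = t :=
      hemb.toHomeomorph.symm_apply_eq.2 rfl
    simp [this, hγ.extend_apply]
  · rintro _ ⟨t, rfl⟩
    rw [hγ.extend_apply]
    simpa using h_exp (mem_univ (t : ℝ))

lemma exists_continuousOn_union {X Y : Type*} [TopologicalSpace X] [TopologicalSpace Y]
    {A B : Set X} (hA : IsClosed A) (hB : IsClosed B) {u v : X → Y} (hu : ContinuousOn u A)
    (hv : ContinuousOn v B) (huv : ∀ z ∈ A ∩ B, u z = v z) :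
    ∃ g : X → Y, ContinuousOn g (A ∪ B) ∧ EqOn g u A ∧ EqOn g v B := by
  classical
  have h1 : EqOn (A.piecewise u v) u A := fun z hz => piecewise_eq_of_mem _ _ _ hz
  have h2 : EqOn (A.piecewise u v) v B := fun z hz => by
    by_cases hzA : z ∈ A
    · rw [piecewise_eq_of_mem _ _ _ hzA, huv z ⟨hzA, hz⟩]
    · exact piecewise_eq_of_notMem _ _ _ hzA
  exact ⟨A.piecewise u v, (hu.congr h1).union_of_isClosed (hv.congr h2) hA hB, h1, h2⟩

lemma exists_logs_eq_at {X : Type*} [TopologicalSpace X] {A B : Set X}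
    (hA : HasContinuousLogs A) (hB : HasContinuousLogs B) {a : X} (ha : a ∈ A ∩ B)
    {f : X → ℂ} (hf : ContinuousOn f (A ∪ B)) (hne : ∀ z ∈ A ∪ B, f z ≠ 0) :
    ∃ u v : X → ℂ, ContinuousOn u A ∧ ContinuousOn v B ∧ (∀ z ∈ A, Complex.exp (u z) = f z) ∧
      (∀ z ∈ B, Complex.exp (v z) = f z) ∧ u a = v a := by
  obtain ⟨u, hu, hu'⟩ := hA f (hf.mono subset_union_left) fun z hz => hne z (Or.inl hz)
  obtain ⟨v, hv, hv'⟩ := hB f (hf.mono subset_union_right) fun z hz => hne z (Or.inr hz)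
  refine ⟨u, fun z => v z + (u a - v a), hu, hv.add continuousOn_const, hu', fun z hz => ?_, ?_⟩
  · rw [Complex.exp_add, Complex.exp_sub, hu' a ha.1, hv' a ha.2,
      div_self (hne a (Or.inl ha.1)), mul_one, hv' z hz]
  · ring

lemma HasContinuousLogs.union_of_inter_eq_singleton {X : Type*} [TopologicalSpace X] {A B : Set X}
    (hA : HasContinuousLogs A) (hB : HasContinuousLogs B) (hAc : IsClosed A) (hBc : IsClosed B)
    {a : X} (hAB : A ∩ B = {a}) : HasContinuousLogs (A ∪ B) := by
  intro f hf hne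
  obtain ⟨u, v, hu, hv, hu', hv', huv⟩ :=
    exists_logs_eq_at hA hB (hAB.symm ▸ mem_singleton a) hf hne
  obtain ⟨g, hg, hgu, hgv⟩ := exists_continuousOn_union hAc hBc hu hv (by
    rw [hAB]
    rintro z rfl
    exact huv)
  refine ⟨g, hg, ?_⟩
  rintro z (hz | hz)
  · rw [hgu hz, hu' z hz]
  · rw [hgv hz, hv' z hz]

/-- On a union of two closed sets with continuous logarithms which meet in two points, any two
nonvanishing continuous functions are multiplicatively dependent modulo exponentials. -/
lemma exists_log_zpow_mul_zpow {X : Type*} [TopologicalSpace X] {A B : Set X}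
    (hA : HasContinuousLogs A) (hB : HasContinuousLogs B) (hAc : IsClosed A) (hBc : IsClosed B)
    {a b : X} (hAB : A ∩ B = {a, b}) {f₁ f₂ : X → ℂ}
    (hf₁ : ContinuousOn f₁ (A ∪ B)) (hne₁ : ∀ z ∈ A ∪ B, f₁ z ≠ 0)
    (hf₂ : ContinuousOn f₂ (A ∪ B)) (hne₂ : ∀ z ∈ A ∪ B, f₂ z ≠ 0) :
    ∃ k₁ k₂ : ℤ, (k₁ ≠ 0 ∨ k₂ ≠ 0) ∧ ∃ g : X → ℂ, ContinuousOn g (A ∪ B) ∧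
      ∀ z ∈ A ∪ B, Complex.exp (g z) = f₁ z ^ k₁ * f₂ z ^ k₂ := by
  have ha : a ∈ A ∩ B := by simp [hAB]
  have hb : b ∈ A ∩ B := by simp [hAB]
  obtain ⟨u₁, v₁, hu₁, hv₁, hu₁', hv₁', huv₁⟩ := exists_logs_eq_at hA hB ha hf₁ hne₁
  obtain ⟨u₂, v₂, hu₂, hv₂, hu₂', hv₂', huv₂⟩ := exists_logs_eq_at hA hB ha hf₂ hne₂
  obtain ⟨m₁, hm₁⟩ := Complex.exp_eq_exp_iff_exists_int.1
    ((hu₁' b hb.1).trans (hv₁' b hb.2).symm)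
  obtain ⟨m₂, hm₂⟩ := Complex.exp_eq_exp_iff_exists_int.1
    ((hu₂' b hb.1).trans (hv₂' b hb.2).symm)
  obtain ⟨k₁, k₂, hk, hkm⟩ : ∃ k₁ k₂ : ℤ, (k₁ ≠ 0 ∨ k₂ ≠ 0) ∧ k₁ * m₁ + k₂ * m₂ = 0 := by
    by_cases h : m₁ = 0
    · exact ⟨1, 0, by simp, by simp [h]⟩
    · exact ⟨m₂, -m₁, by simp [h], by ring⟩
  obtain ⟨g, hg, hgu, hgv⟩ := exists_continuousOn_union hAc hBc
    (u := fun z => k₁ * u₁ z + k₂ * u₂ z) (v := fun z => k₁ * v₁ z + k₂ * v₂ z)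
    ((hu₁.const_mul _).add (hu₂.const_mul _)) ((hv₁.const_mul _).add (hv₂.const_mul _)) (by
      rw [hAB]
      rintro z (rfl | rfl)
      · rw [huv₁, huv₂]
      · rw [hm₁, hm₂]
        have : (k₁ * m₁ + k₂ * m₂ : ℂ) = 0 := by exact_mod_cast hkm
        linear_combination (2 * Real.pi * Complex.I) * this)
  refine ⟨k₁, k₂, hk, g, hg, ?_⟩
  rintro z (hz | hz)
  · rw [hgu hz, Complex.exp_add, Complex.exp_int_mul, Complex.exp_int_mul, hu₁' z hz, hu₂' z hz]
  · rw [hgv hz, Complex.exp_add, Complex.exp_int_mul, Complex.exp_int_mul, hv₁' z hz, hv₂' z hz]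

/-- A nonzero power of `z - p` has no continuous logarithm along a circle centred at `p`. -/
lemma eq_zero_of_exp_eq_sub_zpow {h : ℂ → ℂ} (hh : Continuous h) {p : ℂ} {k : ℤ} {R : ℝ}
    (hR : 0 < R) (hexp : ∀ z, dist z p = R → Complex.exp (h z) = (z - p) ^ k) : k = 0 := by
  have h_circle (θ : ℝ) : Complex.exp (h (p + R * Complex.exp (θ * Complex.I)) -
      k * (θ * Complex.I)) = (R : ℂ) ^ k := by
    rw [Complex.exp_sub, Complex.exp_int_mul, hexp]
    · rw [add_sub_cancel_left, mul_zpow, mul_div_assoc, div_self, mul_one]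
      exact zpow_ne_zero _ (Complex.exp_ne_zero _)
    · simp [dist_eq_norm, Complex.norm_exp_ofReal_mul_I, abs_of_pos hR]
  have h_const := Complex.isCoveringMap_exp.const_of_comp
    (g := fun θ : ℝ => h (p + R * Complex.exp (θ * Complex.I)) - k * (θ * Complex.I))
    (by fun_prop) (fun θ θ' => Subtype.ext ((h_circle θ).trans (h_circle θ').symm)) 0
    (2 * Real.pi)
  simp only [Complex.ofReal_zero, zero_mul, Complex.exp_zero, Complex.ofReal_mul,
    Complex.ofReal_ofNat, Complex.exp_two_pi_mul_I, mul_zero, sub_zero] at h_const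
  have : (k : ℂ) * (2 * Real.pi * Complex.I) = 0 := by linear_combination h_const
  simpa [Real.pi_ne_zero] using this

lemma closure_connectedComponentIn_compl_subset {X : Type*} [TopologicalSpace X]
    [LocallyConnectedSpace X] {K : Set X} (hK : IsClosed K) (p : X) :
    closure (connectedComponentIn Kᶜ p) ⊆ connectedComponentIn Kᶜ p ∪ K := by
  intro z hz
  by_cases hzK : z ∈ K
  · exact Or.inr hzK
  left
  obtain ⟨w, hwz, hwp⟩ := mem_closure_iff.1 hz _ hK.isOpen_compl.connectedComponentIn
    (mem_connectedComponentIn hzK)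
  rw [connectedComponentIn_eq hwp, ← connectedComponentIn_eq hwz]
  exact mem_connectedComponentIn hzK

lemma eq_zero_of_exp_eq_zpow_mul_zpow {K : Set ℂ} (hK : IsClosed K) {p q : ℂ} (hp : p ∉ K)
    (hq : q ∉ K) (hpq : q ∉ connectedComponentIn Kᶜ p)
    (hbdd : Bornology.IsBounded (connectedComponentIn Kᶜ p)) {k l : ℤ} {g : ℂ → ℂ}
    (hg : ContinuousOn g K) (hexp : ∀ z ∈ K, Complex.exp (g z) = (z - p) ^ k * (z - q) ^ l) :
    k = 0 := by
  set U := connectedComponentIn Kᶜ p with hU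
  have hpU : p ∈ U := mem_connectedComponentIn hp
  have hUo : IsOpen U := hK.isOpen_compl.connectedComponentIn
  have hcl : closure U ⊆ U ∪ K := closure_connectedComponentIn_compl_subset hK p
  obtain ⟨G, hG⟩ := ContinuousMap.exists_restrict_eq hK
    ⟨K.domRestrict g, continuousOn_iff_continuous_domRestrict.1 hg⟩
  have hGg (z : ℂ) (hz : z ∈ K) : G z = g z := DFunLike.congr_fun hG ⟨z, hz⟩
  have hclq (z : ℂ) (hz : z ∈ closure U) : z - q ≠ 0 := by
    intro h
    rw [sub_eq_zero.1 h] at hz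
    exact (hcl hz).elim hpq hq
  have hUp (z : ℂ) (hz : z ∈ Uᶜ) : z - p ≠ 0 := by
    intro h
    exact hz (sub_eq_zero.1 h ▸ hpU)
  obtain ⟨H, hH, hHU, hHU'⟩ := exists_continuousOn_union (isClosed_closure (s := U))
    hUo.isClosed_compl (u := fun z => Complex.exp (G z) * (z - q) ^ (-l))
    (v := fun z => (z - p) ^ k)
    ((Complex.continuous_exp.comp G.continuous).continuousOn.mul
      ((continuous_id.sub continuous_const).continuousOn.zpow₀ _ fun z hz => Or.inl (hclq z hz)))
    ((continuous_id.sub continuous_const).continuousOn.zpow₀ _ fun z hz => Or.inl (hUp z hz))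
    (by
      rintro z ⟨hz, hzU⟩
      have hzK : z ∈ K := (hcl hz).resolve_left hzU
      rw [hGg z hzK, hexp z hzK, mul_assoc, ← zpow_add₀ (hclq z hz)]
      simp)
  have hcover : closure U ∪ Uᶜ = univ :=
    eq_univ_of_forall fun z => (em (z ∈ U)).imp (fun h => subset_closure h) id
  rw [hcover] at hH
  obtain ⟨h, hh, h_exp⟩ := Complex.exists_continuousOn_eqOn_exp_comp
    (isSimplyConnected_univ) isOpen_univ hH
    (by
      rintro ⟨z, -, hz⟩
      rcases hcover.symm ▸ mem_univ z with hzU | hzU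
      · rw [hHU hzU] at hz
        exact mul_ne_zero (Complex.exp_ne_zero _) (zpow_ne_zero _ (hclq z hzU)) hz
      · rw [hHU' hzU] at hz
        exact zpow_ne_zero _ (hUp z hzU) hz)
  obtain ⟨R, hR, hUR⟩ := hbdd.subset_ball_lt 0 p
  refine eq_zero_of_exp_eq_sub_zpow (continuousOn_univ.1 hh) hR (p := p) fun z hz => ?_
  have hzU : z ∈ Uᶜ := fun h => (Metric.mem_ball.1 (hUR h)).ne hz
  exact (h_exp (mem_univ z)).trans (hHU' hzU)

lemma isPreconnected_setOf_lt_norm (R : ℝ) :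
    IsPreconnected {z : ℂ | R < ‖z‖} := by
  have : {z : ℂ | R < ‖z‖} =
      (fun x : ℝ × ℝ => (x.1 : ℂ) * Complex.exp (x.2 * Complex.I)) '' (Ioi R ×ˢ univ) := by
    ext z
    constructor
    · intro hz
      exact ⟨(‖z‖, z.arg), ⟨hz, mem_univ _⟩, Complex.norm_mul_exp_arg_mul_I z⟩
    · rintro ⟨⟨r, θ⟩, ⟨hr, -⟩, rfl⟩
      have hr : R < r := hr
      simpa [Complex.norm_exp_ofReal_mul_I] using hr.trans_le (le_abs_self r)
  rw [this]
  exact (isPreconnected_Ioi.prod isPreconnected_univ).image _ (by fun_prop)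

lemma mem_connectedComponentIn_of_not_isBounded {K : Set ℂ} (hK : Bornology.IsBounded K)
    {p q : ℂ} (hq : q ∉ K)
    (hp' : ¬ Bornology.IsBounded (connectedComponentIn Kᶜ p))
    (hq' : ¬ Bornology.IsBounded (connectedComponentIn Kᶜ q)) :
    q ∈ connectedComponentIn Kᶜ p := by
  obtain ⟨R, hR, hKR⟩ := hK.subset_ball_lt 0 0
  have hsub : {z : ℂ | R < ‖z‖} ⊆ Kᶜ := fun z hz hzK => by
    have := mem_ball_zero_iff.1 (hKR hzK)
    exact lt_asymm this hz
  have key (x : ℂ) (hx : ¬ Bornology.IsBounded (connectedComponentIn Kᶜ x)) :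
      {z : ℂ | R < ‖z‖} ⊆ connectedComponentIn Kᶜ x := by
    obtain ⟨w, hw, hwR⟩ : ∃ w ∈ connectedComponentIn Kᶜ x, R < ‖w‖ := by
      by_contra! h
      exact hx ((Metric.isBounded_closedBall (x := 0) (r := R)).subset fun w hw =>
        mem_closedBall_zero_iff.2 (h w hw))
    rw [connectedComponentIn_eq hw]
    exact (isPreconnected_setOf_lt_norm R).subset_connectedComponentIn hwR hsub
  have hmem : ((R + 1 : ℝ) : ℂ) ∈ {z : ℂ | R < ‖z‖} := by
    rw [mem_ofPred_eq, Complex.norm_real]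
    exact (lt_add_one R).trans_le (le_abs_self _)
  rw [connectedComponentIn_eq (key p hp' hmem), ← connectedComponentIn_eq (key q hq' hmem)]
  exact mem_connectedComponentIn hq

lemma connectedComponentIn_comm {X : Type*} [TopologicalSpace X] {F : Set X} {x y : X}
    (hx : x ∈ F) (h : y ∈ connectedComponentIn F x) : x ∈ connectedComponentIn F y := by
  rw [← connectedComponentIn_eq h]
  exact mem_connectedComponentIn hx

/-- The complement of a Jordan curve, presented as the union of two compact sets with continuous
logarithms meeting in two points, has at most two components. -/
lemma mem_connectedComponentIn_of_three_points {A B : Set ℂ}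
    (hA : HasContinuousLogs A) (hB : HasContinuousLogs B) (hAc : IsCompact A) (hBc : IsCompact B)
    {a b : ℂ} (hAB : A ∩ B = {a, b}) {x y z : ℂ} (hx : x ∉ A ∪ B) (hy : y ∉ A ∪ B)
    (hz : z ∉ A ∪ B) :
    y ∈ connectedComponentIn (A ∪ B)ᶜ x ∨ z ∈ connectedComponentIn (A ∪ B)ᶜ x ∨
      z ∈ connectedComponentIn (A ∪ B)ᶜ y := by
  have hK : IsCompact (A ∪ B) := hAc.union hBc
  have key (p q : ℂ) (hp : p ∉ A ∪ B) (hq : q ∉ A ∪ B)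
      (hp' : Bornology.IsBounded (connectedComponentIn (A ∪ B)ᶜ p))
      (hq' : Bornology.IsBounded (connectedComponentIn (A ∪ B)ᶜ q)) :
      q ∈ connectedComponentIn (A ∪ B)ᶜ p := by
    by_contra hpq
    obtain ⟨k, l, hkl, g, hg, hexp⟩ := exists_log_zpow_mul_zpow hA hB hAc.isClosed hBc.isClosed
      hAB (f₁ := fun w => w - p) (f₂ := fun w => w - q) (by fun_prop)
      (fun w hw h => hp (sub_eq_zero.1 h ▸ hw)) (by fun_prop)
      (fun w hw h => hq (sub_eq_zero.1 h ▸ hw))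
    rcases hkl with hk | hl
    · exact hk (eq_zero_of_exp_eq_zpow_mul_zpow hK.isClosed hp hq hpq hp' hg hexp)
    · exact hl (eq_zero_of_exp_eq_zpow_mul_zpow hK.isClosed hq hp
        (fun h => hpq (connectedComponentIn_comm hq h)) hq' hg
        fun w hw => (hexp w hw).trans (mul_comm _ _))
  have key' (p q : ℂ) := mem_connectedComponentIn_of_not_isBounded hK.isBounded (p := p) (q := q)
  have hxy := key x y hx hy
  have hxz := key x z hx hz
  have hyz := key y z hy hz
  have hxy' := key' x y hy
  have hxz' := key' x z hz
  have hyz' := key' y z hz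
  tauto

lemma HasContinuousLogs.image {X Y : Type*} [TopologicalSpace X] [TopologicalSpace Y]
    (e : X ≃ₜ Y) {K : Set X} (hK : HasContinuousLogs K) : HasContinuousLogs (e '' K) := by
  intro f hf hne
  obtain ⟨g, hg, hexp⟩ := hK (f ∘ e) (hf.comp e.continuous.continuousOn (mapsTo_image e K))
    fun z hz => hne _ (mem_image_of_mem e hz)
  refine ⟨g ∘ e.symm, hg.comp e.symm.continuous.continuousOn ?_, ?_⟩
  · rintro _ ⟨z, hz, rfl⟩
    simpa using hz
  · rintro _ ⟨z, hz, rfl⟩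
    simpa using hexp z hz

lemma mem_connectedComponentIn_of_three_points_prod {A B : Set (ℝ × ℝ)}
    (hA : HasContinuousLogs A) (hB : HasContinuousLogs B) (hAc : IsCompact A) (hBc : IsCompact B)
    {a b : ℝ × ℝ} (hAB : A ∩ B = {a, b}) {x y z : ℝ × ℝ} (hx : x ∉ A ∪ B) (hy : y ∉ A ∪ B)
    (hz : z ∉ A ∪ B) :
    y ∈ connectedComponentIn (A ∪ B)ᶜ x ∨ z ∈ connectedComponentIn (A ∪ B)ᶜ x ∨
      z ∈ connectedComponentIn (A ∪ B)ᶜ y := by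
  let e : ℝ × ℝ ≃ₜ ℂ := Complex.equivRealProdCLM.symm.toHomeomorph
  have hmem (p : ℝ × ℝ) : e p ∈ e '' A ∪ e '' B ↔ p ∈ A ∪ B := by
    rw [← image_union, e.injective.mem_set_image]
  have hcomp (p q : ℝ × ℝ) (hp : p ∉ A ∪ B)
      (h : e q ∈ connectedComponentIn (e '' A ∪ e '' B)ᶜ (e p)) :
      q ∈ connectedComponentIn (A ∪ B)ᶜ p := by
    rwa [← image_union, ← image_compl_eq e.bijective, ← e.image_connectedComponentIn hp,
      e.injective.mem_set_image] at h
  have := mem_connectedComponentIn_of_three_points (hA.image e) (hB.image e)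
    (hAc.image e.continuous) (hBc.image e.continuous) (a := e a) (b := e b)
    (by rw [← image_inter e.injective, hAB, image_pair]) (mt (hmem x).1 hx) (mt (hmem y).1 hy)
    (mt (hmem z).1 hz)
  exact this.imp (hcomp x y hx) (Or.imp (hcomp x z hx) (hcomp y z hy))

section PlanarEmbedding

variable {V : Type*} {Γ : SimpleGraph V}

lemma PlanarEmbedding.imageOf_mono (f : PlanarEmbedding Γ) {W W' : Set V} (h : W ⊆ W') :
    f.imageOf W ⊆ f.imageOf W' :=
  union_subset_union (image_mono h) <| iUnion_mono fun _ => iUnion_mono fun _ =>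
    iUnion_mono' fun he => ⟨fun x hx => h (he x hx), Subset.rfl⟩

lemma PlanarEmbedding.emap_subset_imageOf (f : PlanarEmbedding Γ) {W : Set V} {e : Sym2 V}
    (he : e ∈ Γ.edgeSet) (heW : ∀ x ∈ e, x ∈ W) : f.emap e ⊆ f.imageOf W := fun _ hx =>
  Or.inr (mem_iUnion.2 ⟨e, mem_iUnion.2 ⟨he, mem_iUnion.2 ⟨heW, hx⟩⟩⟩)

lemma PlanarEmbedding.vmap_mem_emap (f : PlanarEmbedding Γ) {u v : V} (h : Γ.Adj u v) :
    f.vmap u ∈ f.emap s(u, v) ∧ f.vmap v ∈ f.emap s(u, v) := by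
  obtain ⟨γ, -, hγ⟩ := f.arc h
  rw [← hγ]
  exact ⟨⟨0, γ.source⟩, ⟨1, γ.target⟩⟩

lemma PlanarEmbedding.isCompact_emap (f : PlanarEmbedding Γ) {u v : V} (h : Γ.Adj u v) :
    IsCompact (f.emap s(u, v)) := by
  obtain ⟨γ, -, hγ⟩ := f.arc h
  rw [← hγ]
  exact isCompact_range γ.continuous

lemma PlanarEmbedding.hasContinuousLogs_emap (f : PlanarEmbedding Γ) {u v : V}
    (h : Γ.Adj u v) : HasContinuousLogs (f.emap s(u, v)) := by
  obtain ⟨γ, hinj, hγ⟩ := f.arc h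
  rw [← hγ]
  exact hasContinuousLogs_range_of_injective γ.toContinuousMap hinj

lemma PlanarEmbedding.exists_eq_vmap_of_mem_emap (f : PlanarEmbedding Γ) {e e' : Sym2 V}
    (he : e ∈ Γ.edgeSet) (he' : e' ∈ Γ.edgeSet) (hne : e ≠ e') {x : ℝ × ℝ} (hx : x ∈ f.emap e)
    (hx' : x ∈ f.emap e') : ∃ v, x = f.vmap v ∧ v ∈ e ∧ v ∈ e' := by
  obtain ⟨v, rfl⟩ := f.disjointEdges e he e' he' hne ⟨hx, hx'⟩
  exact ⟨v, rfl, f.vertexOnEdge e he v hx, f.vertexOnEdge e' he' v hx'⟩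

lemma PlanarEmbedding.vmap_mem_imageOf_iff (f : PlanarEmbedding Γ) {W : Set V} {v : V} :
    f.vmap v ∈ f.imageOf W ↔ v ∈ W := by
  refine ⟨?_, fun h => Or.inl (mem_image_of_mem _ h)⟩
  rintro (⟨w, hw, hwv⟩ | h)
  · exact f.inj hwv ▸ hw
  · simp only [mem_iUnion] at h
    obtain ⟨e, he, heW, hv⟩ := h
    exact heW v (f.vertexOnEdge e he v hv)

/-- A point on an edge with an endpoint outside `W` which also lies on the image of `W` is the
image of a vertex of that edge. -/
lemma PlanarEmbedding.exists_eq_vmap_of_mem_imageOf (f : PlanarEmbedding Γ) {W : Set V}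
    {e : Sym2 V} (he : e ∈ Γ.edgeSet) {v : V} (hv : v ∈ e) (hvW : v ∉ W) {x : ℝ × ℝ}
    (hx : x ∈ f.emap e) (hxW : x ∈ f.imageOf W) : ∃ w, x = f.vmap w ∧ w ∈ e ∧ w ∈ W := by
  rcases hxW with ⟨w, hw, rfl⟩ | h
  · exact ⟨w, rfl, f.vertexOnEdge e he w hx, hw⟩
  · simp only [mem_iUnion] at h
    obtain ⟨e', he', heW', hx'⟩ := h
    have hne : e ≠ e' := by
      rintro rfl
      exact hvW (heW' v hv)
    obtain ⟨w, hxw, hwe, hwe'⟩ := f.exists_eq_vmap_of_mem_emap he he' hne hx hx'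
    exact ⟨w, hxw, hwe, heW' w hwe'⟩

/-- Every point of the image of `K` off the image of `W` lies in the same complementary component
as some vertex of `K` outside `W`. -/
lemma PlanarEmbedding.exists_vertex_mem_connectedComponentIn (f : PlanarEmbedding Γ)
    {W K : Set V} {x : ℝ × ℝ} (hxK : x ∈ f.imageOf K) (hxW : x ∉ f.imageOf W) :
    ∃ v ∈ K \ W, x ∈ connectedComponentIn (f.imageOf W)ᶜ (f.vmap v) := by
  rcases hxK with ⟨v, hv, rfl⟩ | h
  · exact ⟨v, ⟨hv, mt f.vmap_mem_imageOf_iff.2 hxW⟩, mem_connectedComponentIn hxW⟩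
  simp only [mem_iUnion] at h
  obtain ⟨e, he, heK, hxe⟩ := h
  obtain ⟨v, hve, hvW⟩ : ∃ v ∈ e, v ∉ W := by
    by_contra! h
    exact hxW (f.emap_subset_imageOf he h hxe)
  obtain ⟨u, rfl⟩ := hve
  obtain ⟨γ, hinj, hγ⟩ := f.arc (Γ.mem_edgeSet.1 he)
  obtain ⟨t, rfl⟩ := hγ.symm ▸ hxe
  refine ⟨v, ⟨heK v (Sym2.mem_mk_left v u), hvW⟩, ?_⟩
  have hpre : IsPreconnected (γ '' Iic t) :=
    isPreconnected_Iic.image _ γ.continuous.continuousOn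
  refine hpre.subset_connectedComponentIn ⟨0, unitInterval.nonneg', γ.source⟩ ?_
    ⟨t, mem_Iic.2 le_rfl, rfl⟩
  rintro _ ⟨s, hs, rfl⟩ hsW
  obtain ⟨w, hsw, hwe, hwW⟩ := f.exists_eq_vmap_of_mem_imageOf he (Sym2.mem_mk_left v u) hvW
    (hγ ▸ mem_range_self s) hsW
  rcases Sym2.mem_iff.1 hwe with rfl | rfl
  · exact hvW hwW
  · have hs1 : s = 1 := hinj (hsw.trans γ.target.symm)
    have : s = t := le_antisymm hs (hs1 ▸ unitInterval.le_one')
    exact hxW (this ▸ hsW)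

lemma PlanarEmbedding.imageOf_range_fourCycle (f : PlanarEmbedding Γ) {c : Fin 4 → V}
    (hc : IsInducedFourCycle Γ c) :
    f.imageOf (range c) = (f.emap s(c 0, c 1) ∪ f.emap s(c 1, c 2)) ∪
      (f.emap s(c 2, c 3) ∪ f.emap s(c 3, c 0)) := by
  have hadj (i : Fin 4) : Γ.Adj (c i) (c (i + 1)) := (hc.2 i (i + 1)).2 (Or.inl rfl)
  have hsub (i : Fin 4) : f.emap s(c i, c (i + 1)) ⊆ (f.emap s(c 0, c 1) ∪ f.emap s(c 1, c 2)) ∪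
      (f.emap s(c 2, c 3) ∪ f.emap s(c 3, c 0)) := by
    fin_cases i
    · exact fun x hx => Or.inl (Or.inl hx)
    · exact fun x hx => Or.inl (Or.inr hx)
    · exact fun x hx => Or.inr (Or.inl hx)
    · exact fun x hx => Or.inr (Or.inr hx)
  refine Subset.antisymm ?_ ?_
  · rintro x (⟨_, ⟨i, rfl⟩, rfl⟩ | h)
    · exact hsub i (f.vmap_mem_emap (hadj i)).1
    · simp only [mem_iUnion] at h
      obtain ⟨e, he, hec, hx⟩ := h
      induction e with
      | _ u v =>
        obtain ⟨i, rfl⟩ := hec u (Sym2.mem_mk_left u v)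
        obtain ⟨j, rfl⟩ := hec v (Sym2.mem_mk_right (c i) v)
        rcases (hc.2 i j).1 he with rfl | rfl
        · exact hsub i hx
        · exact hsub j (Sym2.eq_swap ▸ hx)
  · have hsup (i : Fin 4) : f.emap s(c i, c (i + 1)) ⊆ f.imageOf (range c) :=
      f.emap_subset_imageOf (hadj i) fun _ hx => by
        rcases Sym2.mem_iff.1 hx with rfl | rfl <;> exact mem_range_self _
    exact union_subset (union_subset (hsup 0) (hsup 1)) (union_subset (hsup 2) (hsup 3))

/-- The image of a 4-cycle has at most two complementary components. -/
lemma PlanarEmbedding.mem_connectedComponentIn_fourCycle (f : PlanarEmbedding Γ) {c : Fin 4 → V}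
    (hc : IsInducedFourCycle Γ c) {x y z : ℝ × ℝ} (hx : x ∉ f.imageOf (range c))
    (hy : y ∉ f.imageOf (range c)) (hz : z ∉ f.imageOf (range c)) :
    y ∈ connectedComponentIn (f.imageOf (range c))ᶜ x ∨
      z ∈ connectedComponentIn (f.imageOf (range c))ᶜ x ∨
      z ∈ connectedComponentIn (f.imageOf (range c))ᶜ y := by
  have h01 : Γ.Adj (c 0) (c 1) := (hc.2 0 1).2 (by decide)
  have h12 : Γ.Adj (c 1) (c 2) := (hc.2 1 2).2 (by decide)
  have h23 : Γ.Adj (c 2) (c 3) := (hc.2 2 3).2 (by decide)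
  have h30 : Γ.Adj (c 3) (c 0) := (hc.2 3 0).2 (by decide)
  have hcne (i j : Fin 4) (hij : i ≠ j) : c i ≠ c j := hc.1.ne hij
  have n01 := hcne 0 1 (by decide)
  have n02 := hcne 0 2 (by decide)
  have n03 := hcne 0 3 (by decide)
  have n12 := hcne 1 2 (by decide)
  have n13 := hcne 1 3 (by decide)
  have n23 := hcne 2 3 (by decide)
  have hinter {s t u v : V} (hst : Γ.Adj s t) (huv : Γ.Adj u v) (hne : s(s, t) ≠ s(u, v))
      {w : ℝ × ℝ} (h1 : w ∈ f.emap s(s, t)) (h2 : w ∈ f.emap s(u, v)) :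
      ∃ a, w = f.vmap a ∧ (a = s ∨ a = t) ∧ (a = u ∨ a = v) := by
    simpa only [Sym2.mem_iff] using f.exists_eq_vmap_of_mem_emap hst huv hne h1 h2
  have hA : f.emap s(c 0, c 1) ∩ f.emap s(c 1, c 2) = {f.vmap (c 1)} := by
    refine Subset.antisymm ?_ (singleton_subset_iff.2
      ⟨(f.vmap_mem_emap h01).2, (f.vmap_mem_emap h12).1⟩)
    rintro w ⟨h1, h2⟩
    obtain ⟨a, rfl, ha, ha'⟩ := hinter h01 h12 (by grind) h1 h2
    grind
  have hB : f.emap s(c 2, c 3) ∩ f.emap s(c 3, c 0) = {f.vmap (c 3)} := by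
    refine Subset.antisymm ?_ (singleton_subset_iff.2
      ⟨(f.vmap_mem_emap h23).2, (f.vmap_mem_emap h30).1⟩)
    rintro w ⟨h1, h2⟩
    obtain ⟨a, rfl, ha, ha'⟩ := hinter h23 h30 (by grind) h1 h2
    grind
  have hAB : (f.emap s(c 0, c 1) ∪ f.emap s(c 1, c 2)) ∩
      (f.emap s(c 2, c 3) ∪ f.emap s(c 3, c 0)) = {f.vmap (c 0), f.vmap (c 2)} := by
    refine Subset.antisymm ?_ (pair_subset
      ⟨Or.inl (f.vmap_mem_emap h01).1, Or.inr (f.vmap_mem_emap h30).2⟩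
      ⟨Or.inr (f.vmap_mem_emap h12).2, Or.inl (f.vmap_mem_emap h23).1⟩)
    rintro w ⟨h1 | h1, h2 | h2⟩
    · obtain ⟨a, rfl, ha, ha'⟩ := hinter h01 h23 (by grind) h1 h2
      grind
    · obtain ⟨a, rfl, ha, ha'⟩ := hinter h01 h30 (by grind) h1 h2
      grind
    · obtain ⟨a, rfl, ha, ha'⟩ := hinter h12 h23 (by grind) h1 h2
      grind
    · obtain ⟨a, rfl, ha, ha'⟩ := hinter h12 h30 (by grind) h1 h2
      grind
  rw [f.imageOf_range_fourCycle hc] at hx hy hz ⊢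
  exact mem_connectedComponentIn_of_three_points_prod
    ((f.hasContinuousLogs_emap h01).union_of_inter_eq_singleton (f.hasContinuousLogs_emap h12)
      (f.isCompact_emap h01).isClosed (f.isCompact_emap h12).isClosed hA)
    ((f.hasContinuousLogs_emap h23).union_of_inter_eq_singleton (f.hasContinuousLogs_emap h30)
      (f.isCompact_emap h23).isClosed (f.isCompact_emap h30).isClosed hB)
    ((f.isCompact_emap h01).union (f.isCompact_emap h12))
    ((f.isCompact_emap h23).union (f.isCompact_emap h30)) hAB hx hy hz

/-- A 4-cycle does not strongly separate a subgraph whose vertices off the cycle all avoid the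
complementary component of some vertex `w` off the cycle. -/
lemma not_stronglySeparatesIn_of_avoids (f : PlanarEmbedding Γ) {c : Fin 4 → V}
    (hc : IsInducedFourCycle Γ c) {K : Set V} {w : V} (hw : w ∉ range c)
    (hK : ∀ v ∈ K \ range c,
      f.vmap w ∉ connectedComponentIn (f.imageOf (range c))ᶜ (f.vmap v)) :
    ¬ StronglySeparatesIn f c K := by
  rintro ⟨x, y, hxK, hyK, hx, hy, hxy⟩
  obtain ⟨u, hu, hux⟩ := f.exists_vertex_mem_connectedComponentIn hxK hx
  obtain ⟨v, hv, hvy⟩ := f.exists_vertex_mem_connectedComponentIn hyK hy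
  rcases f.mem_connectedComponentIn_fourCycle hc hx hy (mt f.vmap_mem_imageOf_iff.1 hw)
    with h | h | h
  · exact hxy h
  · rw [← connectedComponentIn_eq hux] at h
    exact hK u hu h
  · rw [← connectedComponentIn_eq hvy] at h
    exact hK v hv h

end PlanarEmbedding

/-- Lemma `le1`: given a strong visual decomposition `(W₁, W₂)` of `Γ` along
`c`, the 4-cycle `c` does not strongly separate any subgraph of `Γᵢ` containing it, and a
4-cycle in some `Γᵢ` strongly separating `Γᵢ` also strongly separates `Γ`. -/
theorem stmt_9 {V : Type} (Γ : SimpleGraph V) (hSA : StandingAssumptions Γ)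
    (f : PlanarEmbedding Γ) (c : Fin 4 → V) (W₁ W₂ : Set V)
    (hdec : StrongVisualDecomposition f c W₁ W₂) :
    (∀ K : Set V, Set.range c ⊆ K → (K ⊆ W₁ ∨ K ⊆ W₂) →
      ¬ StronglySeparatesIn f c K) ∧
    (∀ W : Set V, (W = W₁ ∨ W = W₂) → ∀ α : Fin 4 → V, IsInducedFourCycle Γ α →
      Set.range α ⊆ W → StronglySeparatesIn f α W → StronglySeparatesIn f α Set.univ) := by
  refine ⟨fun K _ hKW => ?_, fun W _ α _ _ => ?_⟩
  · obtain ⟨hc, -, -, ⟨w₁, hw₁⟩, ⟨w₂, hw₂⟩, hsep, -⟩ := hdec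
    rcases hKW with hKW | hKW
    · exact not_stronglySeparatesIn_of_avoids f hc hw₂.2
        fun v hv => hsep v ⟨hKW hv.1, hv.2⟩ w₂ hw₂
    · exact not_stronglySeparatesIn_of_avoids f hc hw₁.2 fun v hv h =>
        hsep w₁ hw₁ v ⟨hKW hv.1, hv.2⟩
          (connectedComponentIn_comm (mt f.vmap_mem_imageOf_iff.1 hv.2) h)
  · rintro ⟨x, y, hx, hy, h⟩
    exact ⟨x, y, f.imageOf_mono (subset_univ W) hx, f.imageOf_mono (subset_univ W) hy, h⟩

end Paper
end

section
/- Let Γ satisfy the Standing Assumptions with embedding f, and let (Γ_1, Γ_2) be a strong visual decomposition of Γ along a 4-cycle σ with respect to f. If α is a 4-cycle of Γ that does not strongly separate Γ with respect to f, then α is contained in Γ_1 or in Γ_2. -/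
open Set

namespace Paper

/-- A continuous branch of `log ((z - a) / (z - b))` exists on `X`. -/
def HasLogRatio (X : Set ℂ) (a b : ℂ) : Prop :=
  ∃ h : ℂ → ℂ, ContinuousOn h X ∧ ∀ z ∈ X, Complex.exp (h z) * (z - b) = z - a

theorem HasLogRatio.symm {X : Set ℂ} {a b : ℂ} (h : HasLogRatio X a b) : HasLogRatio X b a := by
  obtain ⟨h, hc, he⟩ := h
  refine ⟨fun z => -h z, hc.neg, fun z hz => ?_⟩
  rw [← he z hz, ← mul_assoc, ← Complex.exp_add]
  simp

theorem HasLogRatio.trans {X : Set ℂ} {a b c : ℂ} (h₁ : HasLogRatio X a b)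
    (h₂ : HasLogRatio X b c) : HasLogRatio X a c := by
  obtain ⟨h, hc, he⟩ := h₁
  obtain ⟨k, kc, ke⟩ := h₂
  refine ⟨fun z => h z + k z, hc.add kc, fun z hz => ?_⟩
  rw [Complex.exp_add, mul_assoc, ke z hz, he z hz]

theorem HasLogRatio.of_isPreconnected {X C : Set ℂ} (hX : IsClosed X) (hC : IsPreconnected C)
    (hd : Disjoint C X) {a b : ℂ} (ha : a ∈ C) (hb : b ∈ C) : HasLogRatio X a b := by
  refine hC.induction₂ (HasLogRatio X) (fun x hx => ?_) (fun x y z _ _ _ => HasLogRatio.trans)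
    (fun x y _ _ => HasLogRatio.symm) ha hb
  have hxX : x ∈ Xᶜ := fun h => hd.le_bot ⟨hx, h⟩
  obtain ⟨ε, hε, hball⟩ := Metric.isOpen_iff.1 hX.isOpen_compl x hxX
  filter_upwards [mem_nhdsWithin_of_mem_nhds (Metric.ball_mem_nhds x hε)] with y hy
  apply HasLogRatio.symm
  have hne : ∀ z ∈ X, z - x ≠ 0 := fun z hz h => hxX (sub_eq_zero.1 h ▸ hz)
  have hslit : ∀ z ∈ X, (z - y) / (z - x) ∈ Complex.slitPlane := by
    intro z hz
    have h1 : (z - y) / (z - x) = 1 + (x - y) / (z - x) := by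
      have := hne z hz
      field_simp
      ring
    rw [h1]
    apply Complex.mem_slitPlane_of_norm_lt_one
    rw [norm_div, div_lt_one (norm_pos_iff.2 (hne z hz))]
    have h2 : ε ≤ ‖z - x‖ := by
      by_contra! hlt
      exact hball (by simpa [dist_eq_norm] using hlt) hz
    have h3 : ‖x - y‖ < ε := by
      rw [norm_sub_rev]
      simpa [dist_eq_norm] using hy
    exact h3.trans_le h2
  refine ⟨fun z => Complex.log ((z - y) / (z - x)), ?_, fun z hz => ?_⟩
  · refine ContinuousOn.clog ?_ hslit
    exact (by fun_prop : ContinuousOn (fun z : ℂ => z - y) X).div (by fun_prop) hne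
  · rw [Complex.exp_log (Complex.slitPlane_ne_zero (hslit z hz)), div_mul_cancel₀ _ (hne z hz)]

/-- Two continuous logarithms of the same function on a preconnected set differ by a constant. -/
theorem sub_eq_sub_of_exp_eq {A : Type*} [TopologicalSpace A] {S : Set A} (hS : IsPreconnected S)
    {h k : A → ℂ} (hh : ContinuousOn h S) (hk : ContinuousOn k S)
    (he : ∀ z ∈ S, Complex.exp (h z) = Complex.exp (k z)) {x y : A} (hx : x ∈ S) (hy : y ∈ S) :
    h x - k x = h y - k y := by
  have h1 : Complex.exp (h x - k x) = 1 := by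
    rw [Complex.exp_sub, he x hx, div_self (Complex.exp_ne_zero _)]
  have := Complex.isCoveringMap_exp.eqOn_of_comp_eqOn hS hh
    (hk.add (continuousOn_const (c := h x - k x)))
    (fun z hz => Subtype.ext (by simp [Complex.exp_add, h1, he z hz])) hx (by simp)
  have h2 := this hy
  simp only [Pi.add_apply] at h2
  rw [h2]
  ring

theorem HasLogRatio.union {X Y : Set ℂ} (hX : IsClosed X) (hY : IsClosed Y)
    (hXY : IsConnected (X ∩ Y)) {a b : ℂ} (hb : b ∉ X ∪ Y)
    (h₁ : HasLogRatio X a b) (h₂ : HasLogRatio Y a b) : HasLogRatio (X ∪ Y) a b := by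
  classical
  obtain ⟨h, hc, he⟩ := h₁
  obtain ⟨k, kc, ke⟩ := h₂
  obtain ⟨w, hw⟩ := hXY.nonempty
  have hne : ∀ z ∈ X ∪ Y, z - b ≠ 0 := fun z hz hzb => hb (sub_eq_zero.1 hzb ▸ hz)
  have heq : ∀ z ∈ X ∩ Y, Complex.exp (h z) = Complex.exp (k z) := fun z hz =>
    mul_right_cancel₀ (hne z (Or.inl hz.1)) ((he z hz.1).trans (ke z hz.2).symm)
  have hconst : ∀ z ∈ X ∩ Y, h z = k z + (h w - k w) := fun z hz => by
    rw [← sub_eq_sub_of_exp_eq hXY.isPreconnected (hc.mono inter_subset_left)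
      (kc.mono inter_subset_right) heq hz hw]
    ring
  have hexp : Complex.exp (h w - k w) = 1 := by
    rw [Complex.exp_sub, heq w hw, div_self (Complex.exp_ne_zero _)]
  let g : ℂ → ℂ := fun z => if z ∈ X then h z else k z + (h w - k w)
  have gX : EqOn g h X := fun z hz => if_pos hz
  have gY : EqOn g (fun z => k z + (h w - k w)) Y := fun z hz => by
    by_cases hzX : z ∈ X
    · rw [gX hzX, hconst z ⟨hzX, hz⟩]
    · exact if_neg hzX
  refine ⟨g, ?_, ?_⟩
  · exact (hc.congr gX).union_of_isClosed ((kc.add continuousOn_const).congr gY) hX hY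
  · rintro z (hz | hz)
    · rw [gX hz, he z hz]
    · rw [gY hz, Complex.exp_add, hexp, mul_one, ke z hz]

theorem exists_continuous_log {G : ℂ → ℂ} (hG : Continuous G) (h0 : ∀ z, G z ≠ 0) :
    ∃ H : ℂ → ℂ, Continuous H ∧ ∀ z, Complex.exp (H z) = G z := by
  obtain ⟨F, ⟨-, hF⟩, -⟩ := Complex.isCoveringMap_exp.existsUnique_continuousMap_lifts
    (⟨fun z => ⟨G z, h0 z⟩, by fun_prop⟩ : C(ℂ, {z : ℂ // z ≠ 0})) 0 (Complex.log (G 0))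
    (Subtype.ext (Complex.exp_log (h0 0)))
  exact ⟨F, F.continuous, fun z => congrArg Subtype.val (congrFun hF z)⟩

/-- A nonvanishing continuous function on the plane cannot agree with `z - a` on a circle
centred at `a`. -/
theorem not_eq_sub_on_circle {G : ℂ → ℂ} (hG : Continuous G) (h0 : ∀ z, G z ≠ 0) {a : ℂ} {R : ℝ}
    (hR : ∀ t : ℝ, G (circleMap a R t) = circleMap a R t - a) : False := by
  obtain ⟨H, hH, hexp⟩ := exists_continuous_log hG h0
  have hR0 : (R : ℂ) ≠ 0 := by
    intro h
    apply h0 (circleMap a R 0)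
    rw [hR]
    simpa using h
  have key := sub_eq_sub_of_exp_eq (S := (univ : Set ℝ)) isPreconnected_univ
    (h := fun t : ℝ => H (circleMap a R t)) (k := fun t : ℝ => Complex.log R + t * Complex.I)
    (hH.comp (continuous_circleMap a R)).continuousOn (by fun_prop)
    (fun t _ => by
      rw [hexp, hR, Complex.exp_add, Complex.exp_log hR0]
      simp [circleMap])
    (mem_univ 0) (mem_univ (2 * Real.pi))
  have hper : circleMap a R (2 * Real.pi) = circleMap a R 0 := by simp [circleMap]
  simp only [hper] at key
  have : (2 * Real.pi : ℂ) * Complex.I = 0 := by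
    push_cast at key
    linear_combination key
  exact Complex.two_pi_I_ne_zero this

theorem frontier_connectedComponentIn_compl_subset {L : Set ℂ} (hL : IsClosed L) (a : ℂ) :
    frontier (connectedComponentIn Lᶜ a) ⊆ L := by
  intro z hz
  by_contra hzL
  have hopen := hL.isOpen_compl.connectedComponentIn (x := z)
  obtain ⟨w, hw, hwa⟩ := mem_closure_iff.1 hz.1 _ hopen (mem_connectedComponentIn hzL)
  have hza : z ∈ connectedComponentIn Lᶜ a := by
    rw [connectedComponentIn_eq hwa, ← connectedComponentIn_eq hw]
    exact mem_connectedComponentIn hzL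
  exact hz.2 ((hL.isOpen_compl.connectedComponentIn).interior_eq.symm ▸ hza)

theorem HasLogRatio.mem_of_isBounded {L : Set ℂ} (hL : IsClosed L) {a b : ℂ} (ha : a ∉ L)
    (h : HasLogRatio L a b)
    (hbdd : Bornology.IsBounded (connectedComponentIn Lᶜ a)) :
    b ∈ connectedComponentIn Lᶜ a := by
  classical
  by_contra hbU
  obtain ⟨h, hc, he⟩ := h
  obtain ⟨k, hk⟩ := ContinuousMap.exists_restrict_eq hL ⟨L.domRestrict h, hc.domRestrict⟩
  have hkh : ∀ z ∈ L, k z = h z := fun z hz => DFunLike.congr_fun hk ⟨z, hz⟩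
  set U := connectedComponentIn Lᶜ a with hU
  have haU : a ∈ U := mem_connectedComponentIn ha
  obtain ⟨R, hR0, hR⟩ := hbdd.subset_ball_lt 0 a
  let G : ℂ → ℂ := fun z => if z ∈ U then Complex.exp (k z) * (z - b) else z - a
  have hG : Continuous G := by
    refine Continuous.if (fun z hz => ?_) (by fun_prop) (by fun_prop)
    have hzL := frontier_connectedComponentIn_compl_subset hL a hz
    rw [hkh z hzL, he z hzL]
  refine not_eq_sub_on_circle hG (fun z => ?_) (a := a) (R := R) (fun t => ?_)
  · by_cases hz : z ∈ U
    · simp only [G, if_pos hz]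
      exact mul_ne_zero (Complex.exp_ne_zero _) (sub_ne_zero.2 fun h => hbU (h ▸ hz))
    · simp only [G, if_neg hz]
      exact sub_ne_zero.2 fun h => hz (h ▸ haU)
  · refine if_neg fun hz => ?_
    have := hR hz
    simp [circleMap, abs_of_pos hR0] at this

theorem isPreconnected_compl_closedBall_zero {R : ℝ} (hR : 0 < R) :
    IsPreconnected ((Metric.closedBall (0 : ℂ) R)ᶜ) := by
  have : (Metric.closedBall (0 : ℂ) R)ᶜ = Complex.exp '' {w | Real.log R < w.re} := by
    ext z
    simp only [mem_compl_iff, Metric.mem_closedBall, dist_zero_right, not_le, mem_image,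
      mem_ofPred_eq]
    constructor
    · intro hz
      have hz0 : z ≠ 0 := norm_pos_iff.1 (hR.trans hz)
      exact ⟨Complex.log z, by rw [Complex.log_re]; exact Real.log_lt_log hR hz, Complex.exp_log hz0⟩
    · rintro ⟨w, hw, rfl⟩
      rw [Complex.norm_exp]
      exact (Real.log_lt_iff_lt_exp hR).1 hw
  rw [this]
  exact ((convex_halfSpace_re_gt _).isPreconnected).image _ Complex.continuous_exp.continuousOn

theorem HasLogRatio.exists_isPreconnected {L : Set ℂ} (hL : IsCompact L) {a b : ℂ} (ha : a ∉ L)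
    (hb : b ∉ L) (h : HasLogRatio L a b) :
    ∃ C : Set ℂ, IsPreconnected C ∧ Disjoint C L ∧ a ∈ C ∧ b ∈ C := by
  have hdisj : ∀ x, Disjoint (connectedComponentIn Lᶜ x) L := fun x =>
    disjoint_compl_left.mono_left (connectedComponentIn_subset _ _)
  by_cases hA : Bornology.IsBounded (connectedComponentIn Lᶜ a)
  · exact ⟨_, isPreconnected_connectedComponentIn, hdisj a, mem_connectedComponentIn ha,
      h.mem_of_isBounded hL.isClosed ha hA⟩
  by_cases hB : Bornology.IsBounded (connectedComponentIn Lᶜ b)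
  · exact ⟨_, isPreconnected_connectedComponentIn, hdisj b,
      h.symm.mem_of_isBounded hL.isClosed hb hB, mem_connectedComponentIn hb⟩
  obtain ⟨R, hR0, hR⟩ := hL.isBounded.subset_closedBall_lt 0 0
  have hmeet : ∀ x, ¬ Bornology.IsBounded (connectedComponentIn Lᶜ x) →
      ∃ p ∈ connectedComponentIn Lᶜ x, p ∈ (Metric.closedBall (0 : ℂ) R)ᶜ := by
    intro x hx
    by_contra! hsub
    exact hx (Metric.isBounded_closedBall.subset fun p hp => not_not.1 (hsub p hp))
  obtain ⟨p, hpa, hp⟩ := hmeet a hA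
  obtain ⟨q, hqb, hq⟩ := hmeet b hB
  refine ⟨_, ((isPreconnected_connectedComponentIn (x := a)).union p hpa hp
    (isPreconnected_compl_closedBall_zero hR0)).union q (Or.inr hq) hqb
    (isPreconnected_connectedComponentIn (x := b)), ?_, Or.inl (Or.inl
    (mem_connectedComponentIn ha)), Or.inr (mem_connectedComponentIn hb)⟩
  exact ((hdisj a).union_left (disjoint_compl_left.mono_right hR)).union_left (hdisj b)

/-- Janiszewski's theorem: if neither of two compact planar sets with connected intersection
separates `a` from `b`, then neither does their union. -/
theorem janiszewski {X Y C D : Set (ℝ × ℝ)} (hX : IsCompact X) (hY : IsCompact Y)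
    (hXY : IsConnected (X ∩ Y)) (hC : IsPreconnected C) (hD : IsPreconnected D)
    (hCX : Disjoint C X) (hDY : Disjoint D Y) {a b : ℝ × ℝ} (haC : a ∈ C) (hbC : b ∈ C)
    (haD : a ∈ D) (hbD : b ∈ D) :
    ∃ E : Set (ℝ × ℝ), IsPreconnected E ∧ Disjoint E (X ∪ Y) ∧ a ∈ E ∧ b ∈ E := by
  let e : ℝ × ℝ ≃ₜ ℂ := Complex.equivRealProdCLM.symm.toHomeomorph
  have hXc := hX.image e.continuous
  have hYc := hY.image e.continuous
  have hnot : ∀ x ∈ C, x ∈ D → e x ∉ e '' X ∪ e '' Y := by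
    intro x hx hx'
    rw [← image_union, e.injective.mem_set_image]
    rintro (h | h)
    · exact hCX.le_bot ⟨hx, h⟩
    · exact hDY.le_bot ⟨hx', h⟩
  have hlog : HasLogRatio (e '' X ∪ e '' Y) (e a) (e b) := by
    refine HasLogRatio.union hXc.isClosed hYc.isClosed ?_ (hnot b hbC hbD) ?_ ?_
    · rw [← image_inter e.injective]
      exact hXY.image _ e.continuous.continuousOn
    · exact .of_isPreconnected hXc.isClosed (hC.image _ e.continuous.continuousOn)
        ((disjoint_image_iff e.injective).2 hCX) (mem_image_of_mem _ haC) (mem_image_of_mem _ hbC)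
    · exact .of_isPreconnected hYc.isClosed (hD.image _ e.continuous.continuousOn)
        ((disjoint_image_iff e.injective).2 hDY) (mem_image_of_mem _ haD) (mem_image_of_mem _ hbD)
  obtain ⟨E, hE, hdE, haE, hbE⟩ := hlog.exists_isPreconnected (hXc.union hYc)
    (hnot a haC haD) (hnot b hbC hbD)
  refine ⟨e ⁻¹' E, (e.isPreconnected_preimage).2 hE, ?_, haE, hbE⟩
  rw [disjoint_left]
  intro z hz hzXY
  exact hdE.le_bot ⟨hz, by rw [← image_union]; exact mem_image_of_mem _ hzXY⟩

theorem exists_isCompact_of_mem_connectedComponentIn_compl {K : Set (ℝ × ℝ)}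
    (hK : IsClosed K) {p q : ℝ × ℝ} (hp : p ∉ K) (hq : q ∈ connectedComponentIn Kᶜ p) :
    ∃ Q : Set (ℝ × ℝ), IsCompact Q ∧ IsPreconnected Q ∧ p ∈ Q ∧ q ∈ Q ∧ Disjoint Q K := by
  have hpath := (hK.isOpen_compl.connectedComponentIn (x := p)).isConnected_iff_isPathConnected.1
    (isConnected_connectedComponentIn_iff.2 hp)
  obtain ⟨γ, hγ⟩ := hpath.joinedIn p (mem_connectedComponentIn hp) q hq
  refine ⟨range γ, isCompact_range γ.continuous, isPreconnected_range γ.continuous,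
    ⟨0, γ.source⟩, ⟨1, γ.target⟩, disjoint_left.2 ?_⟩
  rintro _ ⟨t, rfl⟩
  exact connectedComponentIn_subset _ _ (hγ t)

theorem range_eq_of_fin_four {V : Type*} {c : Fin 4 → V} (k : Fin 4) :
    range c = {c k, c (k + 1), c (k + 2), c (k + 3)} := by
  ext w
  simp only [mem_range, mem_insert_iff, mem_singleton_iff, eq_comm (a := w)]
  constructor
  · rintro ⟨i, rfl⟩
    have : i = k ∨ i = k + 1 ∨ i = k + 2 ∨ i = k + 3 := by revert i k; decide
    rcases this with h | h | h | h <;> simp [h]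
  · rintro (h | h | h | h) <;> exact ⟨_, h⟩

namespace PlanarEmbedding

variable {V : Type*} {Γ : SimpleGraph V} (f : PlanarEmbedding Γ)

theorem isCompact_emap_s10 {p q : V} (h : Γ.Adj p q) : IsCompact (f.emap s(p, q)) := by
  obtain ⟨γ, -, hγ⟩ := f.arc h
  exact hγ ▸ isCompact_range γ.continuous

theorem isPreconnected_emap {p q : V} (h : Γ.Adj p q) : IsPreconnected (f.emap s(p, q)) := by
  obtain ⟨γ, -, hγ⟩ := f.arc h
  exact hγ ▸ isPreconnected_range γ.continuous

theorem left_mem_emap {p q : V} (h : Γ.Adj p q) : f.vmap p ∈ f.emap s(p, q) := by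
  obtain ⟨γ, -, hγ⟩ := f.arc h
  exact hγ ▸ ⟨0, γ.source⟩

theorem right_mem_emap {p q : V} (h : Γ.Adj p q) : f.vmap q ∈ f.emap s(p, q) := by
  obtain ⟨γ, -, hγ⟩ := f.arc h
  exact hγ ▸ ⟨1, γ.target⟩

theorem exists_common_vertex {e e' : Sym2 V} (he : e ∈ Γ.edgeSet) (he' : e' ∈ Γ.edgeSet)
    (hne : e ≠ e') {z : ℝ × ℝ} (hz : z ∈ f.emap e) (hz' : z ∈ f.emap e') :
    ∃ w, f.vmap w = z ∧ w ∈ e ∧ w ∈ e' := by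
  obtain ⟨w, rfl⟩ := f.disjointEdges e he e' he' hne ⟨hz, hz'⟩
  exact ⟨w, rfl, f.vertexOnEdge e he w hz, f.vertexOnEdge e' he' w hz'⟩

theorem disjoint_emap {p q r s : V} (h : Γ.Adj p q) (h' : Γ.Adj r s) (hpr : p ≠ r) (hps : p ≠ s)
    (hqr : q ≠ r) (hqs : q ≠ s) : Disjoint (f.emap s(p, q)) (f.emap s(r, s)) := by
  rw [disjoint_left]
  intro z hz hz'
  obtain ⟨w, -, hw, hw'⟩ := f.exists_common_vertex (e := s(p, q)) (e' := s(r, s)) h h'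
    (by simp [hpr, hps]) hz hz'
  simp only [Sym2.mem_iff] at hw hw'
  grind

theorem emap_inter_subset {p q r : V} (h : Γ.Adj p q) (h' : Γ.Adj q r) (hpr : p ≠ r) :
    f.emap s(p, q) ∩ f.emap s(q, r) ⊆ {f.vmap q} := by
  rintro z ⟨hz, hz'⟩
  obtain ⟨w, rfl, hw, hw'⟩ := f.exists_common_vertex (e := s(p, q)) (e' := s(q, r)) h h'
    (by simp [hpr, h.ne]) hz hz'
  simp only [Sym2.mem_iff] at hw hw'
  have : w = q := by grind
  rw [this, mem_singleton_iff]

theorem vmap_mem_imageOf_iff_s10 {W : Set V} {v : V} : f.vmap v ∈ f.imageOf W ↔ v ∈ W := by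
  constructor
  · rintro (⟨w, hw, hwv⟩ | h)
    · exact f.inj hwv ▸ hw
    · simp only [mem_iUnion] at h
      obtain ⟨e, he, heW, hv⟩ := h
      exact heW v (f.vertexOnEdge e he v hv)
  · exact fun h => Or.inl (mem_image_of_mem _ h)

/-- The image of an induced 4-cycle is the union of its four edges. -/
theorem imageOf_fourCycle {x y u v : V} (hxu : Γ.Adj x u) (hxv : Γ.Adj x v) (huy : Γ.Adj u y)
    (hvy : Γ.Adj v y) (hxy : ¬ Γ.Adj x y) (huv : ¬ Γ.Adj u v) :
    f.imageOf {x, u, y, v} =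
      f.emap s(x, u) ∪ f.emap s(x, v) ∪ f.emap s(u, y) ∪ f.emap s(v, y) := by
  refine subset_antisymm ?_ ?_
  · rintro z (⟨w, hw, rfl⟩ | hz)
    · rcases hw with rfl | rfl | rfl | rfl
      · exact Or.inl (Or.inl (Or.inl (f.left_mem_emap hxu)))
      · exact Or.inl (Or.inl (Or.inl (f.right_mem_emap hxu)))
      · exact Or.inl (Or.inr (f.right_mem_emap huy))
      · exact Or.inr (f.left_mem_emap hvy)
    · simp only [mem_iUnion] at hz
      obtain ⟨e, he, heW, hz⟩ := hz
      induction e with | _ p q => ?_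
      have hp := heW p (Sym2.mem_mk_left p q)
      have hq := heW q (Sym2.mem_mk_right p q)
      rw [SimpleGraph.mem_edgeSet] at he
      have hyx := fun h : Γ.Adj y x => hxy h.symm
      have hvu := fun h : Γ.Adj v u => huv h.symm
      simp only [mem_union]
      rcases hp with rfl | rfl | rfl | rfl <;> rcases hq with rfl | rfl | rfl | rfl <;>
        first
          | exact absurd rfl he.ne
          | contradiction
          | tauto
          | (rw [Sym2.eq_swap] at hz; tauto)
  · have hsub : ∀ {p q : V}, Γ.Adj p q → p ∈ ({x, u, y, v} : Set V) → q ∈ ({x, u, y, v} : Set V) →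
        f.emap s(p, q) ⊆ f.imageOf {x, u, y, v} := by
      intro p q hpq hp hq z hz
      refine Or.inr (mem_iUnion.2 ⟨s(p, q), mem_iUnion.2 ⟨hpq, mem_iUnion.2 ⟨?_, hz⟩⟩⟩)
      intro w hw
      rcases Sym2.mem_iff.1 hw with rfl | rfl
      exacts [hp, hq]
    exact union_subset (union_subset (union_subset (hsub hxu (by simp) (by simp))
      (hsub hxv (by simp) (by simp))) (hsub huy (by simp) (by simp))) (hsub hvy (by simp) (by simp))

/-- If `x, y` are joined to each of `a, b, u, v` and the cycle `x a y b` does not separate `u`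
from `v`, then the cycle `x u y v` does not separate `a` from `b`. -/
theorem exists_isPreconnected_of_linked {x y a b u v : V}
    (hxa : Γ.Adj x a) (hxb : Γ.Adj x b) (hxu : Γ.Adj x u) (hxv : Γ.Adj x v)
    (hay : Γ.Adj a y) (hby : Γ.Adj b y) (huy : Γ.Adj u y) (hvy : Γ.Adj v y)
    (hxy : x ≠ y) (huv : u ≠ v) (hau : a ≠ u) (hav : a ≠ v) (hbu : b ≠ u) (hbv : b ≠ v)
    {Q : Set (ℝ × ℝ)} (hQ : IsCompact Q) (hQc : IsPreconnected Q) (huQ : f.vmap u ∈ Q)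
    (hvQ : f.vmap v ∈ Q)
    (hd : Disjoint Q (f.emap s(x, a) ∪ f.emap s(x, b) ∪ f.emap s(a, y) ∪ f.emap s(b, y))) :
    ∃ E : Set (ℝ × ℝ), IsPreconnected E ∧
      Disjoint E (f.emap s(x, u) ∪ f.emap s(x, v) ∪ f.emap s(u, y) ∪ f.emap s(v, y)) ∧
      f.vmap a ∈ E ∧ f.vmap b ∈ E := by
  simp only [disjoint_union_right] at hd
  obtain ⟨⟨⟨dxa, dxb⟩, day⟩, dby⟩ := hd
  have hinter : (f.emap s(x, u) ∪ f.emap s(x, v) ∪ Q) ∩ (f.emap s(u, y) ∪ f.emap s(v, y) ∪ Q)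
      = Q := by
    refine subset_antisymm ?_ (subset_inter subset_union_right subset_union_right)
    have h1 := f.emap_inter_subset hxu huy hxy
    have h2 := f.emap_inter_subset hxv hvy hxy
    have h3 := f.disjoint_emap hxu hvy hxv.ne hxy huv huy.ne
    have h4 := f.disjoint_emap hxv huy hxu.ne hxy huv.symm hvy.ne
    rintro z ⟨(hz | hz) | hz, (hz' | hz') | hz'⟩
    all_goals first
      | exact hz
      | exact hz'
      | exact (h3.le_bot ⟨hz, hz'⟩).elim
      | exact (h4.le_bot ⟨hz, hz'⟩).elim
      | exact h1 ⟨hz, hz'⟩ ▸ huQ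
      | exact h2 ⟨hz, hz'⟩ ▸ hvQ
  obtain ⟨E, hE, hdE, haE, hbE⟩ := janiszewski
    (X := f.emap s(x, u) ∪ f.emap s(x, v) ∪ Q) (Y := f.emap s(u, y) ∪ f.emap s(v, y) ∪ Q)
    (C := f.emap s(a, y) ∪ f.emap s(b, y)) (D := f.emap s(x, a) ∪ f.emap s(x, b))
    (a := f.vmap a) (b := f.vmap b)
    (((f.isCompact_emap_s10 hxu).union (f.isCompact_emap_s10 hxv)).union hQ)
    (((f.isCompact_emap_s10 huy).union (f.isCompact_emap_s10 hvy)).union hQ)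
    (hinter.symm ▸ ⟨⟨_, huQ⟩, hQc⟩)
    ((f.isPreconnected_emap hay).union _ (f.right_mem_emap hay) (f.right_mem_emap hby)
      (f.isPreconnected_emap hby))
    ((f.isPreconnected_emap hxa).union _ (f.left_mem_emap hxa) (f.left_mem_emap hxb)
      (f.isPreconnected_emap hxb))
    (by
      simp only [disjoint_union_right, disjoint_union_left]
      exact ⟨⟨⟨f.disjoint_emap hay hxu hxa.ne' hau hxy.symm huy.ne',
        f.disjoint_emap hby hxu hxb.ne' hbu hxy.symm huy.ne'⟩,
        f.disjoint_emap hay hxv hxa.ne' hav hxy.symm hvy.ne',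
        f.disjoint_emap hby hxv hxb.ne' hbv hxy.symm hvy.ne'⟩, day.symm, dby.symm⟩)
    (by
      simp only [disjoint_union_right, disjoint_union_left]
      exact ⟨⟨⟨f.disjoint_emap hxa huy hxu.ne hxy hau hay.ne,
        f.disjoint_emap hxb huy hxu.ne hxy hbu hby.ne⟩,
        f.disjoint_emap hxa hvy hxv.ne hxy hav hay.ne,
        f.disjoint_emap hxb hvy hxv.ne hxy hbv hby.ne⟩, dxa.symm, dxb.symm⟩)
    (Or.inl (f.left_mem_emap hay)) (Or.inr (f.left_mem_emap hby))
    (Or.inl (f.right_mem_emap hxa)) (Or.inr (f.right_mem_emap hxb))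
  refine ⟨E, hE, hdE.mono_right ?_, haE, hbE⟩
  rintro z (((hz | hz) | hz) | hz)
  · exact Or.inl (Or.inl (Or.inl hz))
  · exact Or.inl (Or.inl (Or.inr hz))
  · exact Or.inr (Or.inl (Or.inl hz))
  · exact Or.inr (Or.inl (Or.inr hz))

end PlanarEmbedding

/-- Lemma `le2`: given a strong visual decomposition `(W₁, W₂)` of `Γ` along a
4-cycle, any 4-cycle `α` of `Γ` that does not strongly separate `Γ` is contained in `W₁` or
`W₂`. -/
theorem stmt_10 {V : Type} (Γ : SimpleGraph V) (hSA : StandingAssumptions Γ)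
    (f : PlanarEmbedding Γ) (c : Fin 4 → V) (W₁ W₂ : Set V)
    (hdec : StrongVisualDecomposition f c W₁ W₂)
    (α : Fin 4 → V) (hα : IsInducedFourCycle Γ α)
    (hns : ¬ StronglySeparatesIn f α Set.univ) :
    Set.range α ⊆ W₁ ∨ Set.range α ⊆ W₂ := by
  by_contra! hcon
  obtain ⟨h₁, h₂⟩ := hcon
  rw [not_subset] at h₁ h₂
  obtain ⟨_, ⟨j, rfl⟩, hb₁⟩ := h₁
  obtain ⟨_, ⟨i, rfl⟩, ha₂⟩ := h₂
  obtain ⟨hc, hcover, hinter, -, -, hsep, hedge⟩ := hdec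
  have hcov : ∀ w, w ∈ W₁ ∨ w ∈ W₂ := fun w =>
    (hcover.symm ▸ mem_univ w : w ∈ W₁ ∪ W₂)
  have ha₁ : α i ∈ W₁ := (hcov _).resolve_right ha₂
  have hb₂ : α j ∈ W₂ := (hcov _).resolve_left hb₁
  have hmem : ∀ w, Γ.Adj w (α i) → Γ.Adj w (α j) → w ∈ range c := by
    intro w hwi hwj
    rw [← hinter]
    exact ⟨((hedge _ _ hwi).resolve_right fun h => ha₂ h.2).1,
      ((hedge _ _ hwj).resolve_left fun h => hb₁ h.2).1⟩
  have hij : j = i + 2 := by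
    have hne : j ≠ i := fun h => hb₁ (h ▸ ha₁)
    have hnadj : ¬ Γ.Adj (α i) (α j) := fun h =>
      (hedge _ _ h).elim (fun h => hb₁ h.2) (fun h => ha₂ h.1)
    rw [hα.2] at hnadj
    revert hne hnadj
    clear * -
    revert i j
    decide
  subst hij
  have hadj : ∀ k l : Fin 4, (l = k + 1 ∨ k = l + 1) → Γ.Adj (α k) (α l) := fun k l => (hα.2 k l).2
  have hadjc : ∀ k l : Fin 4, (l = k + 1 ∨ k = l + 1) → Γ.Adj (c k) (c l) := fun k l => (hc.2 k l).2
  have hxa : Γ.Adj (α (i + 1)) (α i) := hadj _ _ (by clear * -; revert i; decide)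
  have hxb : Γ.Adj (α (i + 1)) (α (i + 2)) := hadj _ _ (by clear * -; revert i; decide)
  have hay : Γ.Adj (α i) (α (i + 3)) := hadj _ _ (by clear * -; revert i; decide)
  have hby : Γ.Adj (α (i + 2)) (α (i + 3)) := hadj _ _ (by clear * -; revert i; decide)
  have hnab : ¬ Γ.Adj (α i) (α (i + 2)) := by
    rw [hα.2]; clear * -; revert i; decide
  have hnxy : ¬ Γ.Adj (α (i + 1)) (α (i + 3)) := by
    rw [hα.2]; clear * -; revert i; decide
  have hxy : α (i + 1) ≠ α (i + 3) := hα.1.ne (by clear * -; revert i; decide)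
  have hrα : range α = {α (i + 1), α i, α (i + 3), α (i + 2)} := by
    rw [range_eq_of_fin_four i]
    grind
  obtain ⟨k, hk⟩ := hmem _ hxa hxb
  obtain ⟨l, hl⟩ := hmem _ hay.symm hby.symm
  have hkl : l = k + 2 := by
    have hne : l ≠ k := by
      rintro rfl
      exact hxy (hk.symm.trans hl)
    rw [← hk, ← hl, hc.2] at hnxy
    revert hne hnxy
    clear * -
    revert k l
    decide
  subst hkl
  have hrc : range c = {α (i + 1), c (k + 1), α (i + 3), c (k + 3)} := by
    rw [range_eq_of_fin_four k, hk, hl]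
  have hxu : Γ.Adj (α (i + 1)) (c (k + 1)) := hk ▸ hadjc _ _ (by clear * -; revert k; decide)
  have hxv : Γ.Adj (α (i + 1)) (c (k + 3)) := hk ▸ hadjc _ _ (by clear * -; revert k; decide)
  have huy : Γ.Adj (c (k + 1)) (α (i + 3)) := hl ▸ hadjc _ _ (by clear * -; revert k; decide)
  have hvy : Γ.Adj (c (k + 3)) (α (i + 3)) := hl ▸ hadjc _ _ (by clear * -; revert k; decide)
  have hnuv : ¬ Γ.Adj (c (k + 1)) (c (k + 3)) := by
    rw [hc.2]; clear * -; revert k; decide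
  have huv : c (k + 1) ≠ c (k + 3) := hc.1.ne (by clear * -; revert k; decide)
  have hac : α i ∉ range c := fun h => ha₂ (hinter.symm ▸ h : α i ∈ W₁ ∩ W₂).2
  have hbc : α (i + 2) ∉ range c := fun h => hb₁ (hinter.symm ▸ h : α (i + 2) ∈ W₁ ∩ W₂).1
  have hau : ∀ m, α i ≠ c m := fun m h => hac ⟨m, h.symm⟩
  have hbu : ∀ m, α (i + 2) ≠ c m := fun m h => hbc ⟨m, h.symm⟩
  have huα : c (k + 1) ∉ range α := by
    rw [hrα]
    rintro (h | h | h | h)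
    exacts [hxu.ne h.symm, hau _ h.symm, huy.ne h, hbu _ h.symm]
  have hvα : c (k + 3) ∉ range α := by
    rw [hrα]
    rintro (h | h | h | h)
    exacts [hxv.ne h.symm, hau _ h.symm, hvy.ne h, hbu _ h.symm]
  have hv_comp : f.vmap (c (k + 3)) ∈
      connectedComponentIn (f.imageOf (range α))ᶜ (f.vmap (c (k + 1))) := by
    by_contra hv
    exact hns ⟨_, _, f.vmap_mem_imageOf_iff_s10.2 (mem_univ _), f.vmap_mem_imageOf_iff_s10.2 (mem_univ _),
      mt f.vmap_mem_imageOf_iff_s10.1 huα, mt f.vmap_mem_imageOf_iff_s10.1 hvα, hv⟩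
  have himα := f.imageOf_fourCycle hxa hxb hay hby hnxy hnab
  have himc := f.imageOf_fourCycle hxu hxv huy hvy hnxy hnuv
  rw [← hrα] at himα
  rw [← hrc] at himc
  have hclosed : IsClosed (f.imageOf (range α)) := by
    rw [himα]
    exact ((((f.isCompact_emap_s10 hxa).union (f.isCompact_emap_s10 hxb)).union
      (f.isCompact_emap_s10 hay)).union (f.isCompact_emap_s10 hby)).isClosed
  obtain ⟨Q, hQ, hQc, huQ, hvQ, hd⟩ := exists_isCompact_of_mem_connectedComponentIn_compl hclosed
    (mt f.vmap_mem_imageOf_iff_s10.1 huα) hv_comp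
  obtain ⟨E, hE, hdE, haE, hbE⟩ := f.exists_isPreconnected_of_linked hxa hxb hxu hxv hay hby huy
    hvy hxy huv (hau _) (hau _) (hbu _) (hbu _) hQ hQc huQ hvQ (himα ▸ hd)
  refine hsep _ ⟨ha₁, hac⟩ _ ⟨hb₂, hbc⟩ (hE.subset_connectedComponentIn haE ?_ hbE)
  exact (himc ▸ hdE).subset_compl_right

end Paper
end
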